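/- arXiv:math/0601151 — 3 statements merged into one kernel-verified Lean document; each statement's English description precedes it below -/
import Mathlib

section
/- There exists a vector s⃗₀ among the five vectors (2,3), (3,2), (2,2,3), (2,3,2), (3,2,2) such that the three real numbers 1, ζ(3), ζ(s⃗₀) are linearly independent over ℚ. -/
open scoped BigOperators

/-- The multiple zeta value `ζ(s₁, …, s_l) = ∑_{n₁ > n₂ > ⋯ > n_l ≥ 1} 1/(n₁^{s₁} ⋯ n_l^{s_l})`,
encoded as a tsum over strictly decreasing tuples of positive integers.
Note `mzv [] = 1` (empty product over the unique empty tuple). -/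
noncomputable def mzv (s : List ℕ) : ℝ :=
  ∑' n : {n : Fin s.length → ℕ // StrictAnti n ∧ ∀ i, 0 < n i},
    ∏ i : Fin s.length, (1 : ℝ) / (n.1 i : ℝ) ^ s.get i

/-- A composition: a nonempty finite tuple of positive integers with first entry ≥ 2. -/
def IsComposition (s : List ℕ) : Prop :=
  s ≠ [] ∧ (∀ a ∈ s, 0 < a) ∧ 2 ≤ s.headI

/-- Membership in the set `B` of nonempty vectors all of whose entries are 2 or 3. -/
def InB (s : List ℕ) : Prop :=
  s ≠ [] ∧ ∀ a ∈ s, a = 2 ∨ a = 3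

/-- If the weighted power sums of the nonzero algebraic numbers `r i` are rational with
denominators dividing the powers of a fixed integer, then the corresponding weighted sum of the
exponentials is not an integer, apart possibly from zero. -/
theorem intCast_add_sum_exp_ne_zero {ι : Type*} [Fintype ι] (r : ι → ℂ) (c : ι → ℤ) (c₀ : ℤ)
    (hc₀ : c₀ ≠ 0) (f : Polynomial ℤ) (hf : f.eval 0 ≠ 0) (hr : ∀ i, r i ∈ f.aroots ℂ)
    (a : ℕ) (ha : 0 < a)
    (hpow : ∀ k : ℕ, ∃ m : ℤ, (a : ℂ) ^ k * ∑ i, (c i : ℂ) * r i ^ k = m) :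
    (c₀ : ℂ) + ∑ i, (c i : ℂ) * Complex.exp (r i) ≠ 0 := by
  intro h0
  obtain ⟨C, hC⟩ := LindemannWeierstrass.exp_polynomial_approx f hf
  set d := f.natDegree with hd
  set S : ℝ := ∑ i, |(c i : ℝ)| with hS
  have hlim : Filter.Tendsto (fun n : ℕ => (a : ℝ) ^ d * |C| * S *
      (((a : ℝ) ^ d * |C|) ^ n / (n.factorial : ℝ))) Filter.atTop (nhds 0) := by
    simpa using (FloorSemiring.tendsto_pow_div_factorial_atTop ((a : ℝ) ^ d * |C|)).const_mul
      ((a : ℝ) ^ d * |C| * S)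
  obtain ⟨N, hN⟩ := Filter.eventually_atTop.1 (hlim.eventually (gt_mem_nhds zero_lt_one))
  obtain ⟨p, hpN, hp⟩ := Nat.exists_infinite_primes
    (N + 1 + (f.eval 0).natAbs + 1 + a + 1 + c₀.natAbs + 1)
  obtain ⟨n, hpn, g, hg, happ⟩ := hC p (by omega) hp
  choose m hm using hpow
  have hp1 := hp.one_lt
  set M : ℤ := ∑ k ∈ Finset.range (p * d + 1), g.coeff k * (a : ℤ) ^ (p * d - k) * m k with hM
  have hgM : (a : ℂ) ^ (p * d) * ∑ i, (c i : ℂ) * Polynomial.aeval (r i) g = M := by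
    have hdeg : g.natDegree < p * d + 1 := by omega
    simp_rw [Polynomial.aeval_eq_sum_range' hdeg, Finset.mul_sum]
    rw [Finset.sum_comm, hM]
    push_cast
    refine Finset.sum_congr rfl fun k hk => ?_
    have hk' : k ≤ p * d := by have := Finset.mem_range.1 hk; omega
    rw [← hm k, Finset.mul_sum, Finset.mul_sum]
    refine Finset.sum_congr rfl fun i _ => ?_
    rw [zsmul_eq_mul]
    have : (a : ℂ) ^ (p * d) = (a : ℂ) ^ (p * d - k) * (a : ℂ) ^ k := by
      rw [← pow_add, Nat.sub_add_cancel hk']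
    rw [this]; ring
  set K : ℤ := (a : ℤ) ^ (p * d) * n * c₀ + p * M with hK
  have hKval : (K : ℂ) = -((a : ℂ) ^ (p * d) *
      ∑ i, (c i : ℂ) * (n • Complex.exp (r i) - p • Polynomial.aeval (r i) g)) := by
    rw [hK]
    push_cast
    rw [← hgM]
    have : (c₀ : ℂ) = - ∑ i, (c i : ℂ) * Complex.exp (r i) := by linear_combination h0
    rw [this]
    simp only [Finset.mul_sum, mul_neg, zsmul_eq_mul, nsmul_eq_mul, ← Finset.sum_neg_distrib,
      ← Finset.sum_add_distrib]
    refine Finset.sum_congr rfl fun i _ => ?_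
    ring
  have hKlt : |(K : ℝ)| < 1 := by
    have h1 : |(K : ℝ)| = ‖(K : ℂ)‖ := by
      rw [Complex.norm_intCast]
    rw [h1, hKval, norm_neg, norm_mul, norm_pow, Complex.norm_natCast]
    have h2 : ‖∑ i, (c i : ℂ) * (n • Complex.exp (r i) - p • Polynomial.aeval (r i) g)‖ ≤
        S * (|C| ^ p / ((p - 1).factorial : ℝ)) := by
      refine (norm_sum_le _ _).trans ?_
      rw [hS, Finset.sum_mul]
      refine Finset.sum_le_sum fun i _ => ?_
      rw [norm_mul, Complex.norm_intCast]
      refine mul_le_mul_of_nonneg_left ((happ (hr i)).trans ?_) (abs_nonneg _)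
      exact div_le_div_of_nonneg_right ((le_abs_self _).trans (abs_pow _ _).le) (by positivity)
    have h3 := hN (p - 1) (by omega)
    refine lt_of_le_of_lt (mul_le_mul_of_nonneg_left h2 (by positivity)) ?_
    convert h3 using 1
    obtain ⟨q, rfl⟩ : ∃ q, p = q + 1 := ⟨p - 1, by omega⟩
    rw [Nat.add_sub_cancel, pow_mul', pow_succ, pow_succ]
    ring
  have hK0 : K = 0 := by
    rw [← Int.abs_lt_one_iff]
    exact_mod_cast hKlt
  have hdvd : (p : ℤ) ∣ (a : ℤ) ^ (p * d) * n * c₀ := by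
    refine ⟨-M, ?_⟩
    rw [hK] at hK0; linarith
  have hpp := Nat.prime_iff_prime_int.1 hp
  rcases hpp.dvd_or_dvd hdvd with h | h
  · rcases hpp.dvd_or_dvd h with h | h
    · have := Int.natCast_dvd_natCast.1 (hpp.dvd_of_dvd_pow h)
      have := Nat.le_of_dvd ha this
      omega
    · exact hpn h
  · have := Nat.le_of_dvd (Int.natAbs_pos.2 hc₀) (Int.natCast_dvd.1 h)
    omega

/-- Power sums of two numbers with rational sum and product have controlled denominators. -/
theorem exists_int_pow_mul_add_pow (y z : ℂ) (D P Q : ℤ) (h1 : D * (y + z) = P)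
    (h2 : D * (y * z) = Q) (k : ℕ) : ∃ m : ℤ, (D : ℂ) ^ k * (y ^ k + z ^ k) = m := by
  induction k using Nat.strong_induction_on with
  | _ k ih =>
    match k with
    | 0 => exact ⟨2, by norm_num⟩
    | 1 => exact ⟨P, by simpa using h1⟩
    | k + 2 =>
      obtain ⟨m1, e1⟩ := ih (k + 1) (by omega)
      obtain ⟨m0, e0⟩ := ih k (by omega)
      refine ⟨P * m1 - Q * D * m0, ?_⟩
      push_cast
      rw [← e1, ← e0, ← h1, ← h2]
      ring

/-- If `α ^ 2` has degree at most two over `ℚ`, witnessed by a conjugate `v`, then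
`exp α ≠ -1`. -/
theorem exp_ne_neg_one_of_sq_quadratic (α β : ℂ) (hα : α ≠ 0) (hβ : β ≠ 0)
    (hne : α ^ 2 ≠ β ^ 2) (s t : ℚ) (hs : α ^ 2 + β ^ 2 = s) (ht : α ^ 2 * β ^ 2 = t) :
    Complex.exp α ≠ -1 := by
  intro hexp
  obtain ⟨a, S, T, ha, hS, hT⟩ : ∃ (a : ℕ) (S T : ℤ), 0 < a ∧ (a : ℂ) * (α ^ 2 + β ^ 2) = S ∧
      (a : ℂ) * (α ^ 2 * β ^ 2) = T := by
    refine ⟨s.den * t.den, s.num * t.den, t.num * s.den, Nat.mul_pos s.den_pos t.den_pos, ?_, ?_⟩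
    · rw [hs]; push_cast
      have : (s.den : ℂ) * s = s.num := by exact_mod_cast Rat.den_mul_eq_num s
      rw [← this]; ring
    · rw [ht]; push_cast
      have : (t.den : ℂ) * t = t.num := by exact_mod_cast Rat.den_mul_eq_num t
      rw [← this]; ring
  have ha0 : (a : ℂ) ≠ 0 := by exact_mod_cast ha.ne'
  let f : Polynomial ℤ :=
    (Polynomial.C (a : ℤ) * Polynomial.X ^ 4 - Polynomial.C S * Polynomial.X ^ 2 +
      Polynomial.C T) *
    (Polynomial.C ((a : ℤ) ^ 2) * Polynomial.X ^ 4 -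
      Polynomial.C (2 * a * S) * Polynomial.X ^ 2 + Polynomial.C (S ^ 2 - 4 * a * T))
  have hfev : ∀ x : ℂ, Polynomial.aeval x f =
      (a : ℂ) ^ 3 * ((x ^ 2 - α ^ 2) * (x ^ 2 - β ^ 2)) *
        ((x ^ 2 - (α + β) ^ 2) * (x ^ 2 - (α - β) ^ 2)) := by
    intro x
    simp only [f, map_mul, map_add, map_sub, map_pow, Polynomial.aeval_X, Polynomial.aeval_C,
      algebraMap_int_eq, Int.coe_castRingHom]
    push_cast
    rw [← hS, ← hT]
    ring
  have hf0 : f.eval 0 ≠ 0 := by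
    intro h
    have h1 : Polynomial.aeval (0 : ℂ) f = 0 := by
      have := Polynomial.aeval_algebraMap_apply_eq_algebraMap_eval (A := ℂ) (0 : ℤ) f
      rw [h] at this
      simpa using this
    rw [hfev] at h1
    have : (α + β) * (α - β) ≠ 0 := by
      intro h; apply hne; linear_combination h
    have h2 := mul_ne_zero_iff.1 this
    simp [ha0, hα, hβ, h2.1, h2.2] at h1
  have hfne : f ≠ 0 := by rintro h; simp [h] at hf0
  let r : Fin 8 → ℂ := ![α, -α, β, -β, α + β, -(α + β), α - β, -(α - β)]
  let c : Fin 8 → ℤ := ![2, 2, 2, 2, 1, 1, 1, 1]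
  have hr : ∀ i, r i ∈ f.aroots ℂ := by
    intro i
    rw [Polynomial.mem_aroots]
    refine ⟨hfne, ?_⟩
    rw [hfev]
    fin_cases i <;> simp only [r, Fin.reduceFinMk, Fin.zero_eta, Fin.mk_one, Fin.isValue,
      Matrix.cons_val] <;> ring
  refine intCast_add_sum_exp_ne_zero r c 4 (by norm_num) f hf0 hr a ha ?_ ?_
  · intro k
    have hsum : ∑ i, (c i : ℂ) * r i ^ k = 2 * (1 + (-1) ^ k) * (α ^ k + β ^ k) +
        (1 + (-1) ^ k) * ((α + β) ^ k + (α - β) ^ k) := by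
      simp only [Fin.sum_univ_eight, r, c]
      simp only [Matrix.cons_val]
      rw [neg_pow α, neg_pow β, neg_pow (α + β), neg_pow (α - β)]
      push_cast
      ring
    rcases Nat.even_or_odd k with hk | hk
    · obtain ⟨j, rfl⟩ := hk
      obtain ⟨m1, e1⟩ := exists_int_pow_mul_add_pow (α ^ 2) (β ^ 2) a S T
        (by exact_mod_cast hS) (by exact_mod_cast hT) j
      obtain ⟨m2, e2⟩ := exists_int_pow_mul_add_pow ((α + β) ^ 2) ((α - β) ^ 2) ((a : ℤ) ^ 2)
        (2 * a * S) (S ^ 2 - 4 * a * T) (by push_cast; rw [← hS]; ring)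
        (by push_cast; rw [← hS, ← hT]; ring) j
      refine ⟨4 * a ^ j * m1 + 2 * m2, ?_⟩
      rw [hsum]
      push_cast at e1 e2 ⊢
      rw [← e1, ← e2]
      rw [← two_mul, pow_mul (-1 : ℂ), pow_mul α, pow_mul β, pow_mul (α + β), pow_mul (α - β)]
      norm_num
      ring
    · refine ⟨0, ?_⟩
      rw [hsum, hk.neg_one_pow]; simp
  · simp only [Fin.sum_univ_eight, r, c]
    simp only [Matrix.cons_val]
    have h1 : Complex.exp (-α) = -1 := by rw [Complex.exp_neg, hexp]; norm_num
    rw [sub_eq_add_neg α β, neg_add, neg_add, neg_neg]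
    simp only [Complex.exp_add, h1, hexp]
    push_cast
    ring

/-- `π ^ 2` is not a rational number. -/
theorem pi_sq_ne_ratCast (q : ℚ) : Real.pi ^ 2 ≠ q := by
  intro h
  have hpi : (Real.pi : ℂ) ^ 2 = q := by exact_mod_cast congrArg (fun x : ℝ => (x : ℂ)) h
  have hα : (Real.pi * Complex.I) ^ 2 = ((-q : ℚ) : ℂ) := by
    rw [mul_pow, Complex.I_sq, hpi]; push_cast; ring
  refine exp_ne_neg_one_of_sq_quadratic (Real.pi * Complex.I) 1 (by simp [Real.pi_ne_zero])
    one_ne_zero ?_ (-q + 1) (-q) (by rw [hα]; push_cast; ring) (by rw [hα]; push_cast; ring)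
    Complex.exp_pi_mul_I
  rw [hα]
  intro h2
  have : (-q : ℚ) = 1 := by exact_mod_cast h2.trans (one_pow 2)
  have hq : (q : ℝ) = -1 := by exact_mod_cast (by linarith : q = -1)
  nlinarith [Real.pi_pos, sq_nonneg Real.pi]

/-- `π ^ 2` is not a root of a monic quadratic polynomial over `ℚ`. -/
theorem pi_sq_quadratic_ne_zero (b c : ℚ) :
    (Real.pi ^ 2) ^ 2 + b * Real.pi ^ 2 + c ≠ 0 := by
  intro h
  have hpi : ((Real.pi : ℂ) ^ 2) ^ 2 + b * (Real.pi : ℂ) ^ 2 + c = 0 := by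
    exact_mod_cast congrArg (fun x : ℝ => (x : ℂ)) h
  have hα : (Real.pi * Complex.I) ^ 2 = -(Real.pi : ℂ) ^ 2 := by
    rw [mul_pow, Complex.I_sq]; ring
  obtain ⟨β, hβ⟩ := IsAlgClosed.exists_pow_nat_eq ((Real.pi : ℂ) ^ 2 + b) two_pos
  refine exp_ne_neg_one_of_sq_quadratic (Real.pi * Complex.I) β (by simp [Real.pi_ne_zero])
    ?_ ?_ b c (by rw [hα, hβ]; ring) (by rw [hα, hβ]; linear_combination -hpi)
    Complex.exp_pi_mul_I
  · rintro rfl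
    refine pi_sq_ne_ratCast (-b) ?_
    have : (Real.pi : ℂ) ^ 2 = ((-b : ℚ) : ℂ) := by push_cast; linear_combination -hβ
    exact_mod_cast this
  · rw [hα, hβ]
    intro h2
    refine pi_sq_ne_ratCast (-b / 2) ?_
    have : (Real.pi : ℂ) ^ 2 = ((-b / 2 : ℚ) : ℂ) := by push_cast; linear_combination -h2 / 2
    exact_mod_cast this

/-- The quotient `(6n)! n! / ((3n)! (2n)!²)` is an integer divisible by every prime in
`(2n, 6n]`. -/
theorem factorization_factorial_quotient (n p : ℕ) (hp : p.Prime) :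
    (((3 * n).factorial * (2 * n).factorial ^ 2).factorization p +
      if 2 * n < p ∧ p ≤ 6 * n then 1 else 0) ≤
      ((6 * n).factorial * n.factorial).factorization p := by
  have hb : ∀ m, m ≤ 6 * n → Nat.log p m < Nat.log p (6 * n) + 1 := fun m hm =>
    Nat.lt_succ_of_le (Nat.log_mono_right hm)
  rw [Nat.factorization_mul (Nat.factorial_ne_zero _) (pow_ne_zero _ (Nat.factorial_ne_zero _)),
    Nat.factorization_mul (Nat.factorial_ne_zero _) (Nat.factorial_ne_zero _),
    Nat.factorization_pow]
  simp only [Finsupp.add_apply, Finsupp.smul_apply, smul_eq_mul]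
  rw [Nat.factorization_factorial hp (hb (3 * n) (by omega)),
    Nat.factorization_factorial hp (hb (2 * n) (by omega)),
    Nat.factorization_factorial hp (hb (6 * n) le_rfl),
    Nat.factorization_factorial hp (hb n (by omega)), Finset.mul_sum, ← Finset.sum_add_distrib,
    ← Finset.sum_add_distrib]
  have key : ∀ q, 0 < q → 3 * n / q = 6 * n / q / 2 ∧ 2 * n / q = 6 * n / q / 3 ∧
      n / q = 6 * n / q / 6 := by
    intro q hq
    refine ⟨?_, ?_, ?_⟩
    · rw [Nat.div_div_eq_div_mul, mul_comm q 2, ← Nat.div_div_eq_div_mul]; congr 1; omega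
    · rw [Nat.div_div_eq_div_mul, mul_comm q 3, ← Nat.div_div_eq_div_mul]; congr 1; omega
    · rw [Nat.div_div_eq_div_mul, mul_comm q 6, ← Nat.div_div_eq_div_mul]; congr 1; omega
  have hle : ∀ i, 3 * n / p ^ i + 2 * (2 * n / p ^ i) ≤ 6 * n / p ^ i + n / p ^ i := by
    intro i
    obtain ⟨h1, h2, h3⟩ := key (p ^ i) (pow_pos hp.pos i)
    rw [h1, h2, h3]
    omega
  split_ifs with h
  · have hmem : 1 ∈ Finset.Ico 1 (Nat.log p (6 * n) + 1) := by
      have := Nat.log_pos hp.one_lt h.2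
      simp; omega
    refine Nat.succ_le_of_lt (Finset.sum_lt_sum (fun i _ => hle i) ⟨1, hmem, ?_⟩)
    rw [pow_one]
    obtain ⟨h1, h2, h3⟩ := key p hp.pos
    have h4 : 2 * n / p = 0 := Nat.div_eq_of_lt h.1
    have h5 : 0 < 6 * n / p := Nat.div_pos h.2 hp.pos
    rw [h1, h3, h4]
    omega
  · rw [add_zero]
    exact Finset.sum_le_sum fun i _ => hle i

theorem factorial_quotient_le (n : ℕ) :
    (6 * n).factorial * n.factorial ≤
      108 ^ n * ((3 * n).factorial * (2 * n).factorial ^ 2) := by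
  induction n with
  | zero => simp
  | succ n ih =>
    have e6 : (6 * (n + 1)).factorial = (6 * n + 6) * (6 * n + 5) * (6 * n + 4) * (6 * n + 3) *
        (6 * n + 2) * (6 * n + 1) * (6 * n).factorial := by
      rw [show 6 * (n + 1) = 6 * n + 5 + 1 by ring]
      simp only [Nat.factorial_succ]; ring
    have e3 : (3 * (n + 1)).factorial = (3 * n + 3) * (3 * n + 2) * (3 * n + 1) *
        (3 * n).factorial := by
      rw [show 3 * (n + 1) = 3 * n + 2 + 1 by ring]
      simp only [Nat.factorial_succ]; ring
    have e2 : (2 * (n + 1)).factorial = (2 * n + 2) * (2 * n + 1) * (2 * n).factorial := by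
      rw [show 2 * (n + 1) = 2 * n + 1 + 1 by ring]
      simp only [Nat.factorial_succ]; ring
    have hpoly : (6 * n + 6) * (6 * n + 5) * (6 * n + 4) * (6 * n + 3) * (6 * n + 2) *
        (6 * n + 1) * (n + 1) ≤
        108 * ((3 * n + 3) * (3 * n + 2) * (3 * n + 1) * ((2 * n + 2) * (2 * n + 1)) ^ 2) := by
      have h : (6 * n + 5) * (6 * n + 1) ≤ 18 * (2 * n + 1) * (n + 1) := by nlinarith
      calc _ = 24 * ((3 * n + 3) * (3 * n + 2) * (3 * n + 1) * (2 * n + 1) * (n + 1)) *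
            ((6 * n + 5) * (6 * n + 1)) := by ring
        _ ≤ 24 * ((3 * n + 3) * (3 * n + 2) * (3 * n + 1) * (2 * n + 1) * (n + 1)) *
            (18 * (2 * n + 1) * (n + 1)) := Nat.mul_le_mul_left _ h
        _ = _ := by ring
    rw [e6, e3, e2, Nat.factorial_succ]
    calc _ = ((6 * n + 6) * (6 * n + 5) * (6 * n + 4) * (6 * n + 3) * (6 * n + 2) *
        (6 * n + 1) * (n + 1)) * ((6 * n).factorial * n.factorial) := by ring
      _ ≤ (108 * ((3 * n + 3) * (3 * n + 2) * (3 * n + 1) * ((2 * n + 2) * (2 * n + 1)) ^ 2)) *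
        (108 ^ n * ((3 * n).factorial * (2 * n).factorial ^ 2)) := Nat.mul_le_mul hpoly ih
      _ = _ := by ring

theorem primorial_six_mul_le (n : ℕ) : primorial (6 * n) ≤ primorial (2 * n) * 108 ^ n := by
  set D := (3 * n).factorial * (2 * n).factorial ^ 2 with hD
  have hD0 : 0 < D := by positivity
  have hN0 : 0 < (6 * n).factorial * n.factorial := by positivity
  obtain ⟨W, hW⟩ : D ∣ (6 * n).factorial * n.factorial := by
    rw [← Nat.factorization_prime_le_iff_dvd hD0.ne' hN0.ne']
    intro p hp
    exact (Nat.le_add_right _ _).trans (factorization_factorial_quotient n p hp)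
  have hW0 : 0 < W := by
    rcases Nat.eq_zero_or_pos W with h | h
    · rw [h, mul_zero] at hW; omega
    · exact h
  have hWle : W ≤ 108 ^ n := by
    have := factorial_quotient_le n
    rw [hW, mul_comm (108 ^ n)] at this
    exact Nat.le_of_mul_le_mul_left this hD0
  have hsplit : primorial (6 * n) = primorial (2 * n) *
      ∏ p ∈ (Finset.Ioc (2 * n) (6 * n)).filter Nat.Prime, p := by
    unfold primorial
    rw [← Finset.prod_union]
    · refine Finset.prod_congr ?_ fun _ _ => rfl
      ext p
      simp only [Finset.mem_union, Finset.mem_filter, Finset.mem_range, Finset.mem_Ioc]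
      constructor
      · rintro ⟨h1, h2⟩
        by_cases h : p < 2 * n + 1
        · exact Or.inl ⟨h, h2⟩
        · exact Or.inr ⟨by omega, h2⟩
      · rintro (⟨h1, h2⟩ | ⟨h1, h2⟩)
        · exact ⟨by omega, h2⟩
        · exact ⟨by omega, h2⟩
    · rw [Finset.disjoint_left]
      intro p h1 h2
      simp only [Finset.mem_filter, Finset.mem_range, Finset.mem_Ioc] at h1 h2
      omega
  rw [hsplit]
  refine Nat.mul_le_mul_left _ (le_trans (Nat.le_of_dvd hW0 ?_) hWle)
  refine Finset.prod_primes_dvd _ (fun p hp => (Finset.mem_filter.1 hp).2.prime) fun p hp => ?_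
  obtain ⟨h1, h2⟩ := Finset.mem_filter.1 hp
  have h3 := factorization_factorial_quotient n p h2
  rw [if_pos (Finset.mem_Ioc.1 h1), ← hD, hW, Nat.factorization_mul hD0.ne' hW0.ne'] at h3
  simp only [Finsupp.add_apply] at h3
  exact Nat.dvd_of_factorization_pos (by omega)

theorem exists_log_primorial_le (c : ℝ) (hc : Real.log 108 < 4 * c) :
    ∃ D : ℝ, ∀ m : ℕ, Real.log (primorial m) ≤ c * m + D := by
  have hL : 0 < Real.log 108 := Real.log_pos (by norm_num)
  have hmono : ∀ {a b : ℕ}, a ≤ b → Real.log (primorial a) ≤ Real.log (primorial b) := by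
    intro a b h
    have := primorial_pos a
    exact Real.log_le_log (by exact_mod_cast this) (by exact_mod_cast primorial_mono h)
  obtain ⟨N, hN⟩ := exists_nat_gt (5 * c / (4 * c - Real.log 108))
  rw [div_lt_iff₀ (by linarith)] at hN
  have hN0 : 0 < N := by
    rcases Nat.eq_zero_or_pos N with h | h
    · rw [h, Nat.cast_zero, zero_mul] at hN; linarith
    · exact h
  refine ⟨Real.log (primorial (6 * N)), fun m => ?_⟩
  induction m using Nat.strong_induction_on with
  | _ m ih =>
    by_cases hm : m ≤ 6 * N
    · have := hmono hm
      have : 0 ≤ c * m := mul_nonneg (by linarith) (Nat.cast_nonneg _)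
      linarith
    · push Not at hm
      obtain ⟨n, hn1, hn2, hn3⟩ : ∃ n, m ≤ 6 * n ∧ 6 * n ≤ m + 5 ∧ N ≤ n :=
        ⟨(m + 5) / 6, by omega, by omega, by omega⟩
      have h1 := hmono hn1
      have h2 : Real.log (primorial (6 * n)) ≤
          Real.log (primorial (2 * n)) + n * Real.log 108 := by
        rw [← Real.log_pow, ← Real.log_mul (by exact_mod_cast (primorial_pos _).ne')
          (by positivity)]
        refine Real.log_le_log (by exact_mod_cast primorial_pos _) ?_
        exact_mod_cast primorial_six_mul_le n
      have h3 := ih (2 * n) (by omega)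
      push_cast at h3
      have h4 : (6 : ℝ) * n ≤ m + 5 := by exact_mod_cast hn2
      have h5 : (N : ℝ) ≤ n := by exact_mod_cast hn3
      have h6 : (N : ℝ) * (4 * c - Real.log 108) ≤ n * (4 * c - Real.log 108) :=
        mul_le_mul_of_nonneg_right h5 (by linarith)
      have h7 : c * (6 * n) ≤ c * (m + 5) := mul_le_mul_of_nonneg_left h4 (by linarith)
      linarith

/-- The cube of `lcm(1, …, n)` grows more slowly than `33.6 ^ n`. -/
theorem tendsto_lcmUpto_pow_three_div :
    Filter.Tendsto (fun n : ℕ => (n.lcmUpto : ℝ) ^ 3 / (168 / 5) ^ n) Filter.atTop (nhds 0) := by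
  obtain ⟨D, hD⟩ := exists_log_primorial_le (Real.log (671 / 20) / 3) (by
    have h1 : 3 * Real.log 108 = Real.log (108 ^ 3) := by rw [Real.log_pow]; norm_num
    have h2 : 4 * Real.log (671 / 20) = Real.log ((671 / 20) ^ 4) := by rw [Real.log_pow]; norm_num
    have h3 : Real.log (108 ^ 3) < Real.log ((671 / 20) ^ 4) :=
      Real.log_lt_log (by norm_num) (by norm_num)
    rw [← h1, ← h2] at h3
    linarith)
  have hε : Real.log (671 / 20) < Real.log (168 / 5) := Real.log_lt_log (by norm_num) (by norm_num)
  have hlim : Filter.Tendsto (fun n : ℕ => (n : ℝ) * ((Real.log (671 / 20) - Real.log (168 / 5)) +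
      3 * D / n + 6 * (Real.log n / (n : ℝ) ^ (1 / 2 : ℝ)))) Filter.atTop Filter.atBot := by
    refine Filter.Tendsto.atTop_mul_neg (C := Real.log (671 / 20) - Real.log (168 / 5))
      (by linarith) tendsto_natCast_atTop_atTop ?_
    have h1 : Filter.Tendsto (fun n : ℕ => 3 * D / (n : ℝ)) Filter.atTop (nhds 0) :=
      tendsto_const_div_atTop_nhds_zero_nat _
    have h2 : Filter.Tendsto (fun n : ℕ => Real.log n / (n : ℝ) ^ (1 / 2 : ℝ)) Filter.atTop
        (nhds 0) :=
      ((isLittleO_log_rpow_atTop (by norm_num : (0 : ℝ) < 1 / 2)).tendsto_div_nhds_zero).comp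
        tendsto_natCast_atTop_atTop
    simpa using (tendsto_const_nhds.add h1).add (h2.const_mul 6)
  refine squeeze_zero' (Filter.Eventually.of_forall fun n => by positivity) ?_
    (Real.tendsto_exp_atBot.comp hlim)
  filter_upwards [Filter.eventually_ge_atTop 1] with n hn
  have hn' : (1 : ℝ) ≤ n := by exact_mod_cast hn
  have hn0 : (0 : ℝ) < n := by linarith
  have hpos : (0 : ℝ) < n.lcmUpto := by exact_mod_cast Nat.lcmUpto_pos n
  rw [Function.comp_apply, ← Real.log_le_iff_le_exp (by positivity),
    Real.log_div (by positivity) (by positivity), Real.log_pow, Real.log_pow,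
    ← Chebyshev.psi_eq_log_lcmUpto]
  have h1 := Chebyshev.psi_sub_theta_le hn'
  rw [Chebyshev.theta_eq_log_primorial, Nat.floor_natCast] at h1
  have h2 := hD n
  have h3 : (n : ℝ) * (Real.log n / (n : ℝ) ^ (1 / 2 : ℝ)) = √n * Real.log n := by
    rw [← Real.sqrt_eq_rpow]
    have : √(n : ℝ) ≠ 0 := (Real.sqrt_pos.2 hn0).ne'
    field_simp
    rw [Real.sq_sqrt hn0.le, mul_comm]
  have h4 : (n : ℝ) * (Real.log (671 / 20) - Real.log (168 / 5) + 3 * D / n +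
      6 * (Real.log n / (n : ℝ) ^ (1 / 2 : ℝ))) =
      n * (Real.log (671 / 20) - Real.log (168 / 5)) + 3 * D + 6 * (√n * Real.log n) := by
    rw [← h3]; field_simp
  rw [h4]
  push_cast
  linarith

/-- The product `C(n, k) C(n + k, k)` as a real number. -/
noncomputable def aperyTerm (n k : ℕ) : ℝ := (n.choose k : ℝ) * ((n + k).choose k : ℝ)

theorem aperyTerm_zero_right (n : ℕ) : aperyTerm n 0 = 1 := by simp [aperyTerm]

theorem aperyTerm_eq_zero {n k : ℕ} (h : n < k) : aperyTerm n k = 0 := by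
  simp [aperyTerm, Nat.choose_eq_zero_of_lt h]

theorem aperyTerm_pos {n k : ℕ} (h : k ≤ n) : 0 < aperyTerm n k := by
  have h1 := Nat.choose_pos h
  have h2 := Nat.choose_pos (Nat.le_add_left k n)
  unfold aperyTerm; positivity

theorem aperyTerm_nonneg (n k : ℕ) : 0 ≤ aperyTerm n k := by unfold aperyTerm; positivity

theorem cast_choose_succ_right_mul (n k : ℕ) :
    (n.choose (k + 1) : ℝ) * (k + 1) = n.choose k * (n - k) := by
  rcases le_or_gt k n with h | h
  · have := Nat.choose_succ_right_eq n k
    rw [← Nat.cast_sub h]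
    exact_mod_cast this
  · simp [Nat.choose_eq_zero_of_lt h, Nat.choose_eq_zero_of_lt (Nat.lt_succ_of_lt h)]

theorem cast_choose_succ_mul (n k : ℕ) :
    ((n + 1).choose k : ℝ) * (n + 1 - k) = (n + 1) * n.choose k := by
  rcases le_or_gt k (n + 1) with h | h
  · have := Nat.choose_mul_succ_eq n k
    have h2 : ((n : ℝ) + 1 - k) = ((n + 1 - k : ℕ) : ℝ) := by push_cast [h]; ring
    rw [h2]
    have h3 : ((n + 1).choose k : ℝ) * ((n + 1 - k : ℕ) : ℝ) = n.choose k * (n + 1) := by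
      exact_mod_cast this.symm
    rw [h3]; ring
  · simp [Nat.choose_eq_zero_of_lt h, Nat.choose_eq_zero_of_lt (show n < k by omega)]

theorem cast_succ_mul_choose (n k : ℕ) :
    ((n + 1).choose (k + 1) : ℝ) * (k + 1) = (n + 1) * n.choose k := by
  exact_mod_cast (Nat.add_one_mul_choose_eq n k).symm

theorem aperyTerm_succ_right (n k : ℕ) :
    aperyTerm n (k + 1) = (n - k) * (n + k + 1) / (k + 1) ^ 2 * aperyTerm n k := by
  have h1 := cast_choose_succ_right_mul n k
  have h2 := cast_succ_mul_choose (n + k) k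
  push_cast at h2
  have hk : (k : ℝ) + 1 ≠ 0 := by positivity
  unfold aperyTerm
  rw [← add_assoc]
  field_simp
  linear_combination ((n + k + 1).choose (k + 1) : ℝ) * (k + 1) * h1 +
    (n.choose k : ℝ) * (n - k) * h2

theorem aperyTerm_succ_succ (n k : ℕ) :
    aperyTerm (n + 1) (k + 1) = (n + k + 2) * (n + k + 1) / (k + 1) ^ 2 * aperyTerm n k := by
  have h1 := cast_succ_mul_choose n k
  have h2 := cast_succ_mul_choose (n + 1 + k) k
  have h3 := cast_choose_succ_mul (n + k) k
  push_cast at h2 h3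
  have hk : (k : ℝ) + 1 ≠ 0 := by positivity
  have hn : (n : ℝ) + 1 ≠ 0 := by positivity
  unfold aperyTerm
  rw [show n + 1 + (k + 1) = n + 1 + k + 1 by ring]
  rw [show n + k + 1 = n + 1 + k by ring] at h3
  field_simp
  linear_combination ((n + 1 + k + 1).choose (k + 1) : ℝ) * (k + 1) * h1 +
    ((n : ℝ) + 1) * n.choose k * h2 + (n + k + 2) * n.choose k * h3

theorem aperyTerm_succ_right_of_succ (n k : ℕ) :
    aperyTerm n (k + 1) = (n - k) * (n + 1 - k) / (k + 1) ^ 2 * aperyTerm (n + 1) k := by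
  rw [aperyTerm_succ_right]
  have h1 := cast_choose_succ_mul n k
  have h3 := cast_choose_succ_mul (n + k) k
  push_cast at h3
  have hk : (k : ℝ) + 1 ≠ 0 := by positivity
  have hn : (n : ℝ) + 1 ≠ 0 := by positivity
  unfold aperyTerm
  rw [show n + k + 1 = n + 1 + k by ring] at h3
  have h4 : ((n : ℝ) + k + 1) * (n.choose k * (n + k).choose k) =
      (n + 1 - k) * ((n + 1).choose k * (n + 1 + k).choose k) := by
    apply mul_left_cancel₀ hn
    linear_combination -((n + 1 + k).choose k : ℝ) * (n + 1) * h1 -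
      n.choose k * (n + 1) * h3
  field_simp
  linear_combination ((n : ℝ) - k) * h4

/-- Apéry's certificate for the recurrence. -/
noncomputable def aperyCert (n k : ℕ) : ℝ :=
  4 * (2 * n + 1) * (k * (2 * k + 1) - (2 * n + 1) ^ 2) * aperyTerm n k ^ 2

theorem aperyCert_sub (n k : ℕ) :
    aperyCert (n + 1) (k + 1) - aperyCert (n + 1) k =
      (n + 2) ^ 3 * aperyTerm (n + 2) (k + 1) ^ 2 -
      (2 * n + 3) * (17 * (n + 1) ^ 2 + 17 * (n + 1) + 5) * aperyTerm (n + 1) (k + 1) ^ 2 +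
      (n + 1) ^ 3 * aperyTerm n (k + 1) ^ 2 := by
  unfold aperyCert
  rw [aperyTerm_succ_right_of_succ n k, aperyTerm_succ_succ (n + 1) k,
    aperyTerm_succ_right (n + 1) k]
  have hk : (k : ℝ) + 1 ≠ 0 := by positivity
  push_cast
  field_simp
  ring

/-- The Apéry numbers. -/
noncomputable def aperyA (n : ℕ) : ℝ := ∑ k ∈ Finset.range (n + 1), aperyTerm n k ^ 2

/-- The correction coefficients in Apéry's second sequence. -/
noncomputable def aperyC (n k : ℕ) : ℝ :=
  ∑ m ∈ Finset.range n, 1 / ((m : ℝ) + 1) ^ 3 +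
    ∑ m ∈ Finset.range k, (-1) ^ m / (2 * ((m : ℝ) + 1) ^ 3 * aperyTerm n (m + 1))

/-- Apéry's second solution of the recurrence. -/
noncomputable def aperyB (n : ℕ) : ℝ :=
  ∑ k ∈ Finset.range (n + 1), aperyTerm n k ^ 2 * aperyC n k

theorem sum_range_aperyTerm (f : ℕ → ℝ) {n N : ℕ} (h : n + 1 ≤ N) :
    ∑ k ∈ Finset.range (n + 1), aperyTerm n k ^ 2 * f k =
      ∑ k ∈ Finset.range N, aperyTerm n k ^ 2 * f k := by
  refine Finset.sum_subset (Finset.range_mono h) fun k _ hk => ?_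
  rw [aperyTerm_eq_zero (by simpa using hk)]
  ring

theorem aperyA_rec (n : ℕ) :
    (n + 2) ^ 3 * aperyA (n + 2) =
      (2 * n + 3) * (17 * (n + 1) ^ 2 + 17 * (n + 1) + 5) * aperyA (n + 1) -
        (n + 1) ^ 3 * aperyA n := by
  have h0 := sum_range_aperyTerm (fun _ => 1) (show n + 1 ≤ n + 3 by omega)
  have h1 := sum_range_aperyTerm (fun _ => 1) (show n + 1 + 1 ≤ n + 3 by omega)
  simp only [mul_one] at h0 h1
  unfold aperyA
  rw [h0, h1, show n + 2 + 1 = n + 3 by ring]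
  have h2 := Finset.sum_range_sub (aperyCert (n + 1)) (n + 2)
  simp only [aperyCert_sub, Finset.sum_add_distrib, Finset.sum_sub_distrib,
    ← Finset.mul_sum] at h2
  rw [Finset.sum_range_succ' (fun k => aperyTerm (n + 2) k ^ 2),
    Finset.sum_range_succ' (fun k => aperyTerm (n + 1) k ^ 2),
    Finset.sum_range_succ' (fun k => aperyTerm n k ^ 2)]
  simp only [aperyTerm_zero_right]
  have h3 : aperyCert (n + 1) (n + 2) = 0 := by
    simp [aperyCert, aperyTerm_eq_zero (show n + 1 < n + 2 by omega)]
  have h4 : aperyCert (n + 1) 0 = -4 * (2 * n + 3) ^ 3 := by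
    simp only [aperyCert, aperyTerm_zero_right]; push_cast; ring
  rw [h3, h4] at h2
  linear_combination h2

theorem aperyC_succ_right (n k : ℕ) :
    aperyC n (k + 1) = aperyC n k + (-1) ^ k / (2 * ((k : ℝ) + 1) ^ 3 * aperyTerm n (k + 1)) := by
  unfold aperyC
  rw [Finset.sum_range_succ, add_assoc]

theorem aperyC_succ_left {n k : ℕ} (h : k ≤ n) :
    aperyC (n + 1) k = aperyC n k +
      (-1) ^ k / (((n : ℝ) + 1) ^ 2 * (n + 1 + k) * aperyTerm n k) := by
  induction k with
  | zero =>
    simp only [aperyC, Finset.sum_range_succ, Finset.range_zero, Finset.sum_empty,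
      aperyTerm_zero_right]
    push_cast
    ring
  | succ k ih =>
    rw [aperyC_succ_right, aperyC_succ_right, ih (by omega), aperyTerm_succ_succ,
      aperyTerm_succ_right n k]
    have ht := (aperyTerm_pos (show k ≤ n by omega)).ne'
    obtain ⟨j, rfl⟩ : ∃ j, n = k + 1 + j := ⟨n - (k + 1), by omega⟩
    have hk : (k : ℝ) + 1 ≠ 0 := by positivity
    have h1 : ((k + 1 + j : ℕ) : ℝ) - k ≠ 0 := by push_cast; ring_nf; positivity
    have h2 : ((k + 1 + j : ℕ) : ℝ) + 1 ≠ 0 := by positivity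
    have h3 : ((k + 1 + j : ℕ) : ℝ) + k + 1 ≠ 0 := by positivity
    have h4 : ((k + 1 + j : ℕ) : ℝ) + k + 2 ≠ 0 := by positivity
    have h5 : ((k + 1 + j : ℕ) : ℝ) + 1 + k ≠ 0 := by positivity
    have h6 : ((k + 1 + j : ℕ) : ℝ) + 1 + ((k + 1 : ℕ) : ℝ) ≠ 0 := by positivity
    generalize aperyTerm (k + 1 + j) k = t at ht
    rw [pow_succ]
    push_cast at *
    field_simp
    ring

/-- Apéry's certificate for the second solution. -/
noncomputable def aperyCert' (n k : ℕ) : ℝ :=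
  aperyCert n k * aperyC n k -
    5 * (2 * n + 1) * (-1) ^ k * k / (n * (n + 1)) * aperyTerm n k

theorem aperyCert'_sub (n k : ℕ) (hk : k ≤ n + 1) :
    aperyCert' (n + 1) (k + 1) - aperyCert' (n + 1) k =
      (n + 2) ^ 3 * (aperyTerm (n + 2) (k + 1) ^ 2 * aperyC (n + 2) (k + 1)) -
      (2 * n + 3) * (17 * (n + 1) ^ 2 + 17 * (n + 1) + 5) *
        (aperyTerm (n + 1) (k + 1) ^ 2 * aperyC (n + 1) (k + 1)) +
      (n + 1) ^ 3 * (aperyTerm n (k + 1) ^ 2 * aperyC n (k + 1)) := by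
  have hk0 : (k : ℝ) + 1 ≠ 0 := by positivity
  have hn1 : (n : ℝ) + 1 ≠ 0 := by positivity
  have hn2 : (n : ℝ) + 2 ≠ 0 := by positivity
  have hu := aperyTerm_pos hk
  rcases Nat.lt_or_ge n k with hlt | hle
  · obtain rfl : k = n + 1 := by omega
    unfold aperyCert' aperyCert
    rw [aperyTerm_eq_zero (show n + 1 < n + 1 + 1 by omega),
      aperyTerm_eq_zero (show n < n + 1 + 1 by omega), aperyC_succ_right (n + 2),
      aperyC_succ_left (le_refl (n + 1)), aperyTerm_succ_succ (n + 1) (n + 1)]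
    generalize aperyTerm (n + 1) (n + 1) = u at *
    have hu' := hu.ne'
    generalize aperyC (n + 1) (n + 1) = c
    have h1 : (n : ℝ) + 1 + (n + 1) + 1 ≠ 0 := by positivity
    have h2 : (n : ℝ) + 1 + (n + 1) + 2 ≠ 0 := by positivity
    have h3 : (n : ℝ) + 1 + 1 ≠ 0 := by positivity
    have h4 : (n : ℝ) + 1 + 1 + (n + 1) ≠ 0 := by positivity
    push_cast
    field_simp
    ring
  · have hprod : aperyTerm n (k + 1) ^ 2 * aperyC n (k + 1) =
        aperyTerm n (k + 1) ^ 2 * aperyC (n + 1) (k + 1) -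
        (-1) ^ (k + 1) * aperyTerm n (k + 1) / (((n : ℝ) + 1) ^ 2 * (n + 1 + (k + 1))) := by
      rcases Nat.lt_or_ge n (k + 1) with h | h
      · rw [aperyTerm_eq_zero h]; ring
      · rw [aperyC_succ_left h]
        have := (aperyTerm_pos h).ne'
        have h1 : (n : ℝ) + 1 + (k + 1) ≠ 0 := by positivity
        push_cast
        field_simp
        ring
    rw [hprod, aperyC_succ_left (show k + 1 ≤ n + 1 by omega)]
    unfold aperyCert' aperyCert
    rw [aperyC_succ_right (n + 1) k, aperyTerm_succ_right_of_succ n k,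
      aperyTerm_succ_succ (n + 1) k, aperyTerm_succ_right (n + 1) k]
    obtain ⟨j, rfl⟩ : ∃ j, n = k + j := ⟨n - k, by omega⟩
    generalize aperyTerm (k + j + 1) k = u at *
    have hu' := hu.ne'
    generalize aperyC (k + j + 1) k = c
    have h1 : (k : ℝ) + j + 1 - k ≠ 0 := by ring_nf; positivity
    have h2 : (k : ℝ) + j + 1 + k + 1 ≠ 0 := by positivity
    have h3 : (k : ℝ) + j + 1 + (k + 1) ≠ 0 := by positivity
    have h4 : (k : ℝ) + j + 1 + 1 + (k + 1) ≠ 0 := by positivity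
    have h5 : (k : ℝ) + j + 1 + 1 ≠ 0 := by positivity
    push_cast at *
    rw [pow_succ]
    field_simp
    ring

theorem aperyB_rec (n : ℕ) :
    (n + 2) ^ 3 * aperyB (n + 2) =
      (2 * n + 3) * (17 * (n + 1) ^ 2 + 17 * (n + 1) + 5) * aperyB (n + 1) -
        (n + 1) ^ 3 * aperyB n := by
  have h0 := sum_range_aperyTerm (aperyC n) (show n + 1 ≤ n + 3 by omega)
  have h1 := sum_range_aperyTerm (aperyC (n + 1)) (show n + 1 + 1 ≤ n + 3 by omega)
  unfold aperyB
  rw [h0, h1, show n + 2 + 1 = n + 3 by ring]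
  have h2 := Finset.sum_range_sub (aperyCert' (n + 1)) (n + 2)
  rw [Finset.sum_congr rfl fun k hk => aperyCert'_sub n k
    (by have := Finset.mem_range.1 hk; omega)] at h2
  simp only [Finset.sum_add_distrib, Finset.sum_sub_distrib, ← Finset.mul_sum] at h2
  rw [Finset.sum_range_succ' (fun k => aperyTerm (n + 2) k ^ 2 * aperyC (n + 2) k),
    Finset.sum_range_succ' (fun k => aperyTerm (n + 1) k ^ 2 * aperyC (n + 1) k),
    Finset.sum_range_succ' (fun k => aperyTerm n k ^ 2 * aperyC n k)]
  have e1 := aperyC_succ_left (Nat.zero_le n)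
  have e2 := aperyC_succ_left (Nat.zero_le (n + 1))
  simp only [aperyTerm_zero_right] at e1 e2 ⊢
  have h3 : aperyCert' (n + 1) (n + 2) = 0 := by
    simp [aperyCert', aperyCert, aperyTerm_eq_zero (show n + 1 < n + 2 by omega)]
  have h4 : aperyCert' (n + 1) 0 = -4 * (2 * n + 3) ^ 3 * aperyC (n + 1) 0 := by
    simp only [aperyCert', aperyCert, aperyTerm_zero_right]; push_cast; ring
  rw [h3, h4] at h2
  rw [e2, e1]
  rw [e1] at h2
  have hn1 : (n : ℝ) + 1 ≠ 0 := by positivity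
  have hn2 : (n : ℝ) + 1 + 1 ≠ 0 := by positivity
  have e3 : ((n : ℝ) + 1) ^ 3 * ((-1) ^ 0 / ((n + 1) ^ 2 * (n + 1 + (0 : ℕ)) * 1)) = 1 := by
    rw [Nat.cast_zero, add_zero]; field_simp
  have e4 : ((n : ℝ) + 2) ^ 3 * ((-1) ^ 0 / (((n + 1 : ℕ) + 1) ^ 2 *
      ((n + 1 : ℕ) + 1 + (0 : ℕ)) * 1)) = 1 := by
    rw [Nat.cast_zero, add_zero, Nat.cast_succ, show (n : ℝ) + 2 = n + 1 + 1 by ring]; field_simp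
  linear_combination h2 + e4 - e3

theorem aperyB_mul_sub (n : ℕ) :
    aperyB (n + 1) * aperyA n - aperyA (n + 1) * aperyB n = 6 / ((n : ℝ) + 1) ^ 3 := by
  induction n with
  | zero =>
    simp [aperyA, aperyB, aperyC, aperyTerm, Finset.sum_range_succ]
    norm_num
  | succ n ih =>
    have h1 := aperyA_rec n
    have h2 := aperyB_rec n
    have hn1 : (n : ℝ) + 1 ≠ 0 := by positivity
    have hn2 : (n : ℝ) + 2 ≠ 0 := by positivity
    push_cast
    rw [show (n : ℝ) + 1 + 1 = n + 2 by ring]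
    rw [eq_div_iff (by positivity)] at ih ⊢
    rw [show n + 1 + 1 = n + 2 by ring]
    linear_combination aperyA (n + 1) * h2 - aperyB (n + 1) * h1 + ih

theorem aperyA_pos (n : ℕ) : 0 < aperyA n := by
  unfold aperyA
  exact Finset.sum_pos' (fun _ _ => sq_nonneg _)
    ⟨0, by simp, by rw [aperyTerm_zero_right]; norm_num⟩

theorem aperyA_mono_succ (n : ℕ) : aperyA n ≤ aperyA (n + 1) := by
  unfold aperyA
  refine (Finset.sum_le_sum_of_subset_of_nonneg (Finset.range_mono (Nat.le_succ (n + 1)))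
    fun _ _ _ => sq_nonneg _).trans' (Finset.sum_le_sum fun k _ => ?_)
  have : aperyTerm n k ≤ aperyTerm (n + 1) k := by
    unfold aperyTerm
    have h1 : n.choose k ≤ (n + 1).choose k := Nat.choose_le_choose k (Nat.le_succ n)
    have h2 : (n + k).choose k ≤ (n + 1 + k).choose k := Nat.choose_le_choose k (by omega)
    gcongr
  have := aperyTerm_nonneg n k
  gcongr

theorem aperyA_succ_ge (c : ℝ) (n : ℕ)
    (h : ((n : ℝ) + 1) ^ 3 * aperyA n ≤ (2 * n + 3) * (17 * (n + 1) ^ 2 + 17 * (n + 1) + 5) *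
      aperyA (n + 1) - c * (n + 2) ^ 3 * aperyA (n + 1)) :
    c * aperyA (n + 1) ≤ aperyA (n + 2) := by
  have h1 := aperyA_rec n
  have h2 : (0 : ℝ) < ((n : ℝ) + 2) ^ 3 := by positivity
  refine le_of_mul_le_mul_left ?_ h2
  linarith

theorem aperyA_growth_weak {n : ℕ} (hn : 200 ≤ n) : 32 * aperyA (n + 1) ≤ aperyA (n + 2) := by
  apply aperyA_succ_ge
  have h0 := aperyA_mono_succ n
  have h1 := aperyA_pos (n + 1)
  have hn' : (200 : ℝ) ≤ n := by exact_mod_cast hn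
  have h3 : ((n : ℝ) + 1) ^ 3 * aperyA n ≤ (n + 1) ^ 3 * aperyA (n + 1) := by gcongr
  obtain ⟨x, rfl⟩ : ∃ x : ℕ, n = 200 + x := ⟨n - 200, by omega⟩
  refine h3.trans ?_
  rw [← sub_nonneg, ← sub_mul, ← sub_mul]
  push_cast
  refine mul_nonneg ?_ h1.le
  ring_nf
  positivity

theorem aperyA_growth {n : ℕ} (hn : 201 ≤ n) :
    168 / 5 * aperyA (n + 1) ≤ aperyA (n + 2) := by
  apply aperyA_succ_ge
  obtain ⟨x, rfl⟩ : ∃ x : ℕ, n = 201 + x := ⟨n - 201, by omega⟩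
  have h0 := aperyA_growth_weak (show 200 ≤ 200 + x by omega)
  rw [show 200 + x + 1 = 201 + x by ring, show 200 + x + 2 = 201 + x + 1 by ring] at h0
  have h1 := aperyA_pos (201 + x + 1)
  have h3 : (((201 + x : ℕ) : ℝ) + 1) ^ 3 * aperyA (201 + x) ≤
      ((201 + x : ℕ) + 1) ^ 3 * (aperyA (201 + x + 1) / 32) := by gcongr; linarith
  refine h3.trans ?_
  rw [mul_div_left_comm, mul_comm, ← sub_nonneg, ← sub_mul, ← sub_mul]
  push_cast
  refine mul_nonneg ?_ h1.le
  ring_nf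
  positivity

theorem exists_aperyA_ge : ∃ c : ℝ, 0 < c ∧ ∀ n : ℕ, 202 ≤ n → c * (168 / 5) ^ n ≤ aperyA n := by
  refine ⟨aperyA 202 / (168 / 5) ^ 202, div_pos (aperyA_pos _) (by positivity), ?_⟩
  intro n hn
  induction n, hn using Nat.le_induction with
  | base => rw [div_mul_cancel₀ _ (by positivity)]
  | succ n hn ih =>
    have h := aperyA_growth (show 201 ≤ n - 1 by omega)
    rw [show n - 1 + 1 = n by omega, show n - 1 + 2 = n + 1 by omega] at h
    rw [pow_succ _ n, ← mul_assoc, mul_comm]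
    exact (mul_le_mul_of_nonneg_left ih (by norm_num)).trans h

theorem tendsto_lcmUpto_pow_three_div_aperyA :
    Filter.Tendsto (fun n : ℕ => (n.lcmUpto : ℝ) ^ 3 / aperyA n) Filter.atTop (nhds 0) := by
  obtain ⟨c, hc, h⟩ := exists_aperyA_ge
  have h1 := tendsto_lcmUpto_pow_three_div.const_mul c⁻¹
  rw [mul_zero] at h1
  refine squeeze_zero' (Filter.Eventually.of_forall fun n => ?_) ?_ h1
  · exact div_nonneg (by positivity) (aperyA_pos n).le
  · filter_upwards [Filter.eventually_ge_atTop 202] with n hn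
    have h2 := h n hn
    rw [inv_mul_eq_div, div_div]
    have : (0 : ℝ) < (168 / 5) ^ n * c := by positivity
    gcongr
    linarith

theorem summable_one_div_succ_pow {k : ℕ} (hk : 2 ≤ k) :
    Summable fun n : ℕ => 1 / ((n : ℝ) + 1) ^ k := by
  have := (summable_nat_add_iff 1).2 (Real.summable_one_div_nat_pow.2 (show 1 < k by omega))
  simpa using this

theorem succ_le_aperyTerm {n m : ℕ} (hm : 1 ≤ m) (hmn : m ≤ n) : (n : ℝ) + 1 ≤ aperyTerm n m := by
  unfold aperyTerm
  have h1 : 1 ≤ n.choose m := Nat.choose_pos hmn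
  have h2 : n + 1 ≤ (n + m).choose m := by
    calc n + 1 = (n + 1).choose n := by simp
      _ ≤ (n + m).choose n := Nat.choose_le_choose n (by omega)
      _ = (n + m).choose m := by
        rw [← Nat.choose_symm (show n ≤ n + m by omega)]; simp
  have h3 : n + 1 ≤ n.choose m * (n + m).choose m := by nlinarith
  exact_mod_cast h3

theorem abs_aperyC_sub_le {n k : ℕ} (hk : k ≤ n) :
    |aperyC n k - ∑ m ∈ Finset.range n, 1 / ((m : ℝ) + 1) ^ 3| ≤
      (∑' m : ℕ, 1 / ((m : ℝ) + 1) ^ 3) / (n + 1) := by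
  unfold aperyC
  rw [add_sub_cancel_left]
  calc |∑ m ∈ Finset.range k, (-1) ^ m / (2 * ((m : ℝ) + 1) ^ 3 * aperyTerm n (m + 1))|
      ≤ ∑ m ∈ Finset.range k, 1 / ((m : ℝ) + 1) ^ 3 / ((n : ℝ) + 1) := by
        refine (Finset.abs_sum_le_sum_abs _ _).trans (Finset.sum_le_sum fun m hm => ?_)
        have hm' := Finset.mem_range.1 hm
        have h1 := succ_le_aperyTerm (show 1 ≤ m + 1 by omega) (show m + 1 ≤ n by omega)
        have h0 : (0 : ℝ) < n + 1 := by positivity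
        have h2 : 0 < aperyTerm n (m + 1) := by linarith
        rw [abs_div, abs_pow, abs_neg, abs_one, one_pow, abs_of_pos (by positivity), div_div]
        gcongr
        have : (0 : ℝ) < ((m : ℝ) + 1) ^ 3 := by positivity
        linarith
    _ = (∑ m ∈ Finset.range k, 1 / ((m : ℝ) + 1) ^ 3) / ((n : ℝ) + 1) := by rw [Finset.sum_div]
    _ ≤ _ := by
        gcongr
        exact (summable_one_div_succ_pow (by norm_num)).sum_le_tsum _ fun _ _ => by positivity

theorem abs_aperyB_div_sub_le (n : ℕ) :
    |aperyB n / aperyA n - ∑ m ∈ Finset.range n, 1 / ((m : ℝ) + 1) ^ 3| ≤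
      (∑' m : ℕ, 1 / ((m : ℝ) + 1) ^ 3) / (n + 1) := by
  have ha := aperyA_pos n
  rw [div_sub' ha.ne', abs_div, abs_of_pos ha, div_le_iff₀ ha]
  unfold aperyB
  conv_rhs => rw [aperyA, Finset.mul_sum]
  rw [aperyA, Finset.sum_mul, ← Finset.sum_sub_distrib]
  refine (Finset.abs_sum_le_sum_abs _ _).trans (Finset.sum_le_sum fun k hk => ?_)
  rw [← mul_sub, abs_mul, abs_of_nonneg (sq_nonneg _), mul_comm]
  gcongr
  exact abs_aperyC_sub_le (by have := Finset.mem_range.1 hk; omega)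

theorem tendsto_aperyB_div :
    Filter.Tendsto (fun n => aperyB n / aperyA n) Filter.atTop
      (nhds (∑' m : ℕ, 1 / ((m : ℝ) + 1) ^ 3)) := by
  have h1 := (summable_one_div_succ_pow (show 2 ≤ 3 by norm_num)).hasSum.tendsto_sum_nat
  have h2 : Filter.Tendsto (fun n : ℕ => (∑' m : ℕ, 1 / ((m : ℝ) + 1) ^ 3) / ((n : ℝ) + 1))
      Filter.atTop (nhds 0) := by
    have := (tendsto_one_div_add_atTop_nhds_zero_nat (𝕜 := ℝ)).const_mul
      (∑' m : ℕ, 1 / ((m : ℝ) + 1) ^ 3)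
    rw [mul_zero] at this
    exact this.congr fun n => mul_one_div _ _
  have h3 := squeeze_zero_norm (fun n => (Real.norm_eq_abs _).trans_le (abs_aperyB_div_sub_le n)) h2
  simpa using h3.add h1

theorem aperyB_div_succ_sub (n : ℕ) :
    aperyB (n + 1) / aperyA (n + 1) - aperyB n / aperyA n =
      6 * (1 / ((n : ℝ) + 1) ^ 3) / (aperyA n * aperyA (n + 1)) := by
  have h := aperyB_mul_sub n
  have h1 := (aperyA_pos n).ne'
  have h2 := (aperyA_pos (n + 1)).ne'
  rw [div_sub_div _ _ h2 h1, mul_one_div, ← h, mul_comm (aperyA n)]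

theorem aperyB_div_lt (n : ℕ) : aperyB n / aperyA n < ∑' m : ℕ, 1 / ((m : ℝ) + 1) ^ 3 := by
  have h : ∀ n, aperyB n / aperyA n < aperyB (n + 1) / aperyA (n + 1) := fun n => by
    rw [← sub_pos, aperyB_div_succ_sub]
    have h1 := aperyA_pos n
    have h2 := aperyA_pos (n + 1)
    positivity
  exact (h n).trans_le ((strictMono_nat_of_lt_succ h).monotone.ge_of_tendsto
    tendsto_aperyB_div (n + 1))

theorem tsum_sub_aperyB_div_le (n : ℕ) :
    (∑' m : ℕ, 1 / ((m : ℝ) + 1) ^ 3) - aperyB n / aperyA n ≤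
      6 * (∑' m : ℕ, 1 / ((m : ℝ) + 1) ^ 3) / aperyA n ^ 2 := by
  have hA : Monotone aperyA := monotone_nat_of_le_succ aperyA_mono_succ
  have ha := aperyA_pos n
  have key : ∀ j, aperyB (n + j) / aperyA (n + j) - aperyB n / aperyA n ≤
      6 * (∑ m ∈ Finset.range (n + j), 1 / ((m : ℝ) + 1) ^ 3) / aperyA n ^ 2 := by
    intro j
    induction j with
    | zero => simp only [add_zero, sub_self]; positivity
    | succ j ih =>
      have h := aperyB_div_succ_sub (n + j)
      rw [← add_assoc, Finset.sum_range_succ]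
      have h2 : 6 * (1 / (((n + j : ℕ) : ℝ) + 1) ^ 3) / (aperyA (n + j) * aperyA (n + j + 1)) ≤
          6 * (1 / (((n + j : ℕ) : ℝ) + 1) ^ 3) / aperyA n ^ 2 := by
        rw [sq]
        have h3 := hA (show n ≤ n + j by omega)
        have h4 := hA (show n ≤ n + j + 1 by omega)
        have h5 := (aperyA_pos (n + j)).le
        gcongr
      rw [mul_add, add_div]
      linarith
  refine le_of_tendsto ((tendsto_aperyB_div.comp (Filter.tendsto_add_atTop_nat n)).sub_const _)
    (Filter.Eventually.of_forall fun j => ?_)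
  simp only [Function.comp]
  rw [add_comm j n]
  refine (key j).trans ?_
  gcongr
  exact (summable_one_div_succ_pow (by norm_num)).sum_le_tsum _ fun _ _ => by positivity

theorem dvd_lcmUpto {m n : ℕ} (h1 : 1 ≤ m) (h2 : m ≤ n) : m ∣ n.lcmUpto := by
  unfold Nat.lcmUpto
  exact Finset.dvd_lcm (f := id) (Finset.mem_Icc.2 ⟨h1, h2⟩)

theorem lcmUpto_dvd_lcmUpto {m n : ℕ} (h : m ≤ n) : m.lcmUpto ∣ n.lcmUpto := by
  unfold Nat.lcmUpto
  exact Finset.lcm_dvd fun b hb => Finset.dvd_lcm (f := id)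
    (Finset.mem_Icc.2 ⟨(Finset.mem_Icc.1 hb).1, (Finset.mem_Icc.1 hb).2.trans h⟩)

theorem exists_int_lcmUpto_div (D : ℕ) {m : ℕ} (h1 : 1 ≤ m) :
    ∀ n, m ≤ n → n.lcmUpto ∣ D → ∃ z : ℤ, (D : ℝ) / (m * n.choose m) = z := by
  induction m, h1 using Nat.le_induction with
  | base =>
    intro n h2 hD
    obtain ⟨c, hc⟩ := (dvd_lcmUpto h2 le_rfl).trans hD
    refine ⟨c, ?_⟩
    have : (n : ℝ) ≠ 0 := by positivity
    rw [hc]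
    push_cast [Nat.choose_one_right]
    field_simp
  | succ m hm ih =>
    intro n h2 hD
    obtain ⟨n, rfl⟩ : ∃ k, n = k + 1 := ⟨n - 1, by omega⟩
    obtain ⟨z1, hz1⟩ := ih n (by omega) ((lcmUpto_dvd_lcmUpto (Nat.le_succ n)).trans hD)
    obtain ⟨z2, hz2⟩ := ih (n + 1) (by omega) hD
    refine ⟨z1 - z2, ?_⟩
    push_cast
    rw [← hz1, ← hz2]
    have e1 := cast_choose_succ_mul n m
    have e2 := cast_succ_mul_choose n m
    have p1 : (n.choose m : ℝ) ≠ 0 := by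
      exact_mod_cast (Nat.choose_pos (show m ≤ n by omega)).ne'
    have p2 : ((n + 1).choose m : ℝ) ≠ 0 := by
      exact_mod_cast (Nat.choose_pos (show m ≤ n + 1 by omega)).ne'
    have p3 : ((n + 1).choose (m + 1) : ℝ) ≠ 0 := by
      exact_mod_cast (Nat.choose_pos (show m + 1 ≤ n + 1 by omega)).ne'
    have hm0 : (m : ℝ) ≠ 0 := by positivity
    have hn0 : (n : ℝ) + 1 ≠ 0 := by positivity
    have h3 : (((m + 1 : ℕ) : ℝ) * ((n + 1).choose (m + 1))) = (n + 1) * n.choose m := by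
      rw [← e2]; push_cast; ring
    push_cast at h3
    rw [h3]
    field_simp
    linear_combination -D * e1

theorem exists_int_aperyTerm_div {n k m : ℕ} (hk : k ≤ n) (hm : 1 ≤ m) (hmk : m ≤ k) :
    ∃ z : ℤ, (n.lcmUpto : ℝ) ^ 3 * aperyTerm n k / ((m : ℝ) ^ 3 * aperyTerm n m) = z := by
  obtain ⟨z1, h1⟩ := exists_int_lcmUpto_div n.lcmUpto hm n (hmk.trans hk) dvd_rfl
  obtain ⟨z2, h2⟩ := exists_int_lcmUpto_div n.lcmUpto hm k hmk (lcmUpto_dvd_lcmUpto hk)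
  obtain ⟨c, hc⟩ := dvd_lcmUpto hm (hmk.trans hk)
  refine ⟨n.choose k * (n + k).choose (k - m) * c * z1 * z2, ?_⟩
  have hsub : ((n + k).choose k : ℝ) * k.choose m =
      (n + k).choose (k - m) * (n + m).choose m := by
    have h := Nat.choose_mul (n := n + k) (show k - m ≤ k by omega)
    rw [Nat.choose_symm hmk, show n + k - (k - m) = n + m by omega,
      show k - (k - m) = m by omega] at h
    exact_mod_cast h
  have hc' : (n.lcmUpto : ℝ) = m * c := by exact_mod_cast hc
  push_cast
  rw [← h1, ← h2]
  have p0 : (m : ℝ) ≠ 0 := by positivity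
  have p1 : (n.choose m : ℝ) ≠ 0 := by
    exact_mod_cast (Nat.choose_pos (hmk.trans hk)).ne'
  have p2 : (k.choose m : ℝ) ≠ 0 := by exact_mod_cast (Nat.choose_pos hmk).ne'
  have p3 : ((n + m).choose m : ℝ) ≠ 0 := by
    exact_mod_cast (Nat.choose_pos (show m ≤ n + m by omega)).ne'
  unfold aperyTerm
  rw [hc']
  field_simp
  linear_combination (c : ℝ) ^ 3 * n.choose k * hsub

theorem exists_int_aperyTerm (n k : ℕ) : ∃ z : ℤ, aperyTerm n k = z :=
  ⟨n.choose k * (n + k).choose k, by simp [aperyTerm]⟩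

theorem exists_int_sum {ι : Type*} (s : Finset ι) (f : ι → ℝ)
    (h : ∀ i ∈ s, ∃ z : ℤ, f i = z) : ∃ z : ℤ, ∑ i ∈ s, f i = z := by
  choose! g hg using h
  exact ⟨∑ i ∈ s, g i, by push_cast; exact Finset.sum_congr rfl hg⟩

theorem exists_int_aperyC {n k : ℕ} (hk : k ≤ n) :
    ∃ z : ℤ, 2 * (n.lcmUpto : ℝ) ^ 3 * (aperyTerm n k * aperyC n k) = z := by
  obtain ⟨t, ht⟩ := exists_int_aperyTerm n k
  obtain ⟨z1, h1⟩ := exists_int_sum (Finset.range n)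
    (fun m => (n.lcmUpto : ℝ) ^ 3 * (1 / ((m : ℝ) + 1) ^ 3)) (fun m hm => by
      obtain ⟨c, hc⟩ := dvd_lcmUpto (show 1 ≤ m + 1 by omega) (Finset.mem_range.1 hm)
      refine ⟨c ^ 3, ?_⟩
      rw [hc]
      push_cast
      field_simp)
  obtain ⟨z2, h2⟩ := exists_int_sum (Finset.range k)
    (fun m => 2 * (n.lcmUpto : ℝ) ^ 3 * (aperyTerm n k *
      ((-1) ^ m / (2 * ((m : ℝ) + 1) ^ 3 * aperyTerm n (m + 1))))) (fun m hm => by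
      obtain ⟨z, hz⟩ := exists_int_aperyTerm_div hk (show 1 ≤ m + 1 by omega)
        (Finset.mem_range.1 hm)
      refine ⟨(-1) ^ m * z, ?_⟩
      push_cast at hz ⊢
      rw [← hz]
      have := (aperyTerm_pos (show m + 1 ≤ n by have := Finset.mem_range.1 hm; omega)).ne'
      field_simp)
  refine ⟨2 * t * z1 + z2, ?_⟩
  push_cast
  rw [← h1, ← h2, ← ht, ← Finset.mul_sum, ← Finset.mul_sum, ← Finset.mul_sum]
  unfold aperyC
  ring

theorem exists_int_aperyB (n : ℕ) : ∃ z : ℤ, 2 * (n.lcmUpto : ℝ) ^ 3 * aperyB n = z := by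
  unfold aperyB
  rw [Finset.mul_sum]
  refine exists_int_sum _ _ fun k hk => ?_
  obtain ⟨t, ht⟩ := exists_int_aperyTerm n k
  obtain ⟨z, hz⟩ := exists_int_aperyC (show k ≤ n by have := Finset.mem_range.1 hk; omega)
  refine ⟨t * z, ?_⟩
  push_cast
  rw [← hz, ← ht]
  ring

theorem exists_int_aperyA (n : ℕ) : ∃ z : ℤ, aperyA n = z := by
  refine exists_int_sum _ _ fun k _ => ?_
  obtain ⟨t, ht⟩ := exists_int_aperyTerm n k
  exact ⟨t ^ 2, by rw [ht]; push_cast; rfl⟩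

/-- Apéry's theorem: `ζ(3)` is irrational. -/
theorem tsum_one_div_cube_ne_ratCast (q : ℚ) : (∑' n : ℕ, 1 / ((n : ℝ) + 1) ^ 3) ≠ (q : ℝ) := by
  intro hq
  have h1 := tendsto_lcmUpto_pow_three_div_aperyA.const_mul (12 * (q : ℝ) * q.den)
  rw [mul_zero] at h1
  obtain ⟨n, hn⟩ := (h1.eventually_lt_const one_pos).exists
  have ha := aperyA_pos n
  obtain ⟨a, hA⟩ := exists_int_aperyA n
  obtain ⟨b, hB⟩ := exists_int_aperyB n
  have hlt := aperyB_div_lt n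
  have hle := tsum_sub_aperyB_div_le n
  rw [hq] at hlt hle
  have hd : (0 : ℝ) < n.lcmUpto := by exact_mod_cast Nat.lcmUpto_pos n
  have hden : (0 : ℝ) < q.den := by exact_mod_cast q.den_pos
  have hqd : (q : ℝ) * q.den = q.num := by exact_mod_cast Rat.mul_den_eq_num q
  have hz : 2 * (n.lcmUpto : ℝ) ^ 3 * q.den * aperyA n * (q - aperyB n / aperyA n) =
      ((2 * n.lcmUpto ^ 3 * a * q.num - q.den * b : ℤ) : ℝ) := by
    push_cast
    rw [← hA, ← hB, ← hqd]
    field_simp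
  have hpos : 0 < 2 * (n.lcmUpto : ℝ) ^ 3 * q.den * aperyA n * (q - aperyB n / aperyA n) := by
    have := sub_pos.2 hlt
    positivity
  have hlt1 : 2 * (n.lcmUpto : ℝ) ^ 3 * q.den * aperyA n * (q - aperyB n / aperyA n) < 1 := by
    refine lt_of_le_of_lt (mul_le_mul_of_nonneg_left hle (by positivity)) (hn.trans_eq' ?_)
    field_simp
    ring
  rw [hz] at hpos hlt1
  have i1 : 0 < 2 * (n.lcmUpto : ℤ) ^ 3 * a * q.num - q.den * b := by exact_mod_cast hpos
  have i2 : 2 * (n.lcmUpto : ℤ) ^ 3 * a * q.num - q.den * b < 1 := by exact_mod_cast hlt1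
  omega

/-- The truncated multiple zeta value `∑_{N ≥ n₁ > n₂ > ⋯ > n_l ≥ 1} 1/(n₁^{s₁} ⋯ n_l^{s_l})`. -/
noncomputable def mzvTrunc : List ℕ → ℕ → ℝ
  | [], _ => 1
  | s :: t, N => ∑ m ∈ Finset.range N, mzvTrunc t m / ((m : ℝ) + 1) ^ s

theorem mzvTrunc_nonneg (s : List ℕ) (N : ℕ) : 0 ≤ mzvTrunc s N := by
  induction s generalizing N with
  | nil => simp [mzvTrunc]
  | cons s t ih => exact Finset.sum_nonneg fun m _ => div_nonneg (ih m) (by positivity)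

theorem strictAnti_cons_iff {l : ℕ} (m : ℕ) (v : Fin l → ℕ) :
    StrictAnti (Fin.cons m v : Fin (l + 1) → ℕ) ↔ (∀ i, v i < m) ∧ StrictAnti v := by
  constructor
  · intro h
    refine ⟨fun i => ?_, fun i j hij => ?_⟩
    · have := h (Fin.succ_pos i)
      simpa using this
    · have := h (Fin.succ_lt_succ_iff.2 hij)
      simpa using this
  · rintro ⟨h1, h2⟩ i j hij
    induction i using Fin.cases with
    | zero =>
      induction j using Fin.cases with
      | zero => exact absurd hij (lt_irrefl _)
      | succ j => simpa using h1 j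
    | succ i =>
      induction j using Fin.cases with
      | zero => exact absurd hij (Fin.not_lt_zero _)
      | succ j => simpa using h2 (Fin.succ_lt_succ_iff.1 hij)

open Classical in
/-- The sum over strictly decreasing tuples bounded by `N`, with values in `[0, ∞]`. -/
noncomputable def mzvBounded (s : List ℕ) (N : ℕ∞) : ENNReal :=
  ∑' n : Fin s.length → ℕ,
    if StrictAnti n ∧ (∀ i, 0 < n i) ∧ ∀ i, (n i : ℕ∞) ≤ N then
      ∏ i : Fin s.length, ENNReal.ofReal ((1 : ℝ) / (n i : ℝ) ^ s.get i) else 0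

theorem mzvBounded_cons (s : ℕ) (t : List ℕ) (N : ℕ∞) :
    mzvBounded (s :: t) N = ∑' m : ℕ, if ((m + 1 : ℕ) : ℕ∞) ≤ N then
      ENNReal.ofReal (1 / ((m + 1 : ℕ) : ℝ) ^ s) * mzvBounded t (m : ℕ) else 0 := by
  classical
  have h0 : mzvBounded (s :: t) N = ∑' m : ℕ, if 0 < m ∧ (m : ℕ∞) ≤ N then
      ENNReal.ofReal (1 / (m : ℝ) ^ s) * mzvBounded t ((m - 1 : ℕ) : ℕ) else 0 := by
    unfold mzvBounded
    simp only [List.length_cons]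
    rw [← (Fin.consEquiv (fun _ : Fin (t.length + 1) => ℕ)).tsum_eq, ENNReal.tsum_prod']
    refine tsum_congr fun m => ?_
    by_cases hm : 0 < m ∧ (m : ℕ∞) ≤ N
    · rw [if_pos hm, ← ENNReal.tsum_mul_left]
      refine tsum_congr fun v => ?_
      have hiff : (StrictAnti (Fin.consEquiv (fun _ : Fin (t.length + 1) => ℕ) (m, v)) ∧
          (∀ i, 0 < Fin.consEquiv (fun _ : Fin (t.length + 1) => ℕ) (m, v) i) ∧
          ∀ i, ((Fin.consEquiv (fun _ : Fin (t.length + 1) => ℕ) (m, v) i : ℕ) : ℕ∞) ≤ N) ↔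
          (StrictAnti v ∧ (∀ i, 0 < v i) ∧ ∀ i, (v i : ℕ∞) ≤ ((m - 1 : ℕ) : ℕ)) := by
        simp only [Fin.consEquiv, Equiv.coe_fn_mk, strictAnti_cons_iff, Fin.forall_fin_succ,
          Fin.cons_zero, Fin.cons_succ, Nat.cast_le]
        constructor
        · rintro ⟨⟨h1, h2⟩, ⟨-, h3⟩, -⟩
          exact ⟨h2, h3, fun i => Nat.le_sub_one_of_lt (h1 i)⟩
        · rintro ⟨h2, h3, h1⟩
          have h1' : ∀ i, v i < m := fun i => by have := h1 i; omega
          exact ⟨⟨h1', h2⟩, ⟨hm.1, h3⟩, hm.2, fun i =>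
            (Nat.cast_le.2 (h1' i).le).trans hm.2⟩
      rw [if_congr hiff rfl rfl]
      split_ifs
      · rw [Fin.prod_univ_succ]
        rfl
      · simp
    · rw [if_neg hm]
      refine ENNReal.tsum_eq_zero.2 fun v => if_neg ?_
      rintro ⟨-, h1, h2⟩
      exact hm ⟨h1 0, h2 0⟩
  rw [h0, tsum_eq_zero_add' ENNReal.summable]
  simp

theorem mzvBounded_natCast (s : List ℕ) (N : ℕ) :
    mzvBounded s N = ENNReal.ofReal (mzvTrunc s N) := by
  induction s generalizing N with
  | nil =>
    unfold mzvBounded mzvTrunc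
    simp only [List.length_nil]
    rw [tsum_eq_single (fun i : Fin 0 => (Fin.elim0 i : ℕ))
      (fun b hb => absurd (Subsingleton.elim _ _) hb)]
    have : StrictAnti (fun i : Fin 0 => (Fin.elim0 i : ℕ)) := fun i => i.elim0
    rw [if_pos ⟨this, fun i => i.elim0, fun i => i.elim0⟩]
    simp
  | cons s t ih =>
    rw [mzvBounded_cons, mzvTrunc, ENNReal.ofReal_sum_of_nonneg
      fun m _ => div_nonneg (mzvTrunc_nonneg t m) (by positivity)]
    rw [tsum_eq_sum (s := Finset.range N) fun m hm => if_neg (by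
      rw [Nat.cast_le]; have := Finset.mem_range.not.1 hm; omega)]
    refine Finset.sum_congr rfl fun m hm => ?_
    rw [if_pos (Nat.cast_le.2 (Finset.mem_range.1 hm)), ih, ← ENNReal.ofReal_mul (by positivity)]
    congr 1
    push_cast
    ring

theorem mzv_eq_toReal (s : List ℕ) : mzv s = (mzvBounded s ⊤).toReal := by
  classical
  unfold mzv mzvBounded
  have h : ∀ n : {n : Fin s.length → ℕ // StrictAnti n ∧ ∀ i, 0 < n i},
      (∏ i : Fin s.length, (1 : ℝ) / (n.1 i : ℝ) ^ s.get i) =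
      (∏ i : Fin s.length, ENNReal.ofReal ((1 : ℝ) / (n.1 i : ℝ) ^ s.get i)).toReal := by
    intro n
    rw [ENNReal.toReal_prod]
    exact Finset.prod_congr rfl fun i _ => (ENNReal.toReal_ofReal (by positivity)).symm
  simp_rw [h]
  rw [← ENNReal.tsum_toReal_eq fun n => ENNReal.prod_ne_top fun i _ => ENNReal.ofReal_ne_top]
  congr 1
  refine (tsum_subtype {n : Fin s.length → ℕ | StrictAnti n ∧ ∀ i, 0 < n i}
    (fun n => ∏ i : Fin s.length, ENNReal.ofReal ((1 : ℝ) / (n i : ℝ) ^ s.get i))).trans ?_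
  refine tsum_congr fun n => ?_
  simp only [Set.indicator, Set.mem_ofPred_eq, le_top, implies_true, and_true]

theorem mzv_cons (s : ℕ) (t : List ℕ) :
    mzv (s :: t) = (∑' m : ℕ, ENNReal.ofReal (mzvTrunc t m / ((m : ℝ) + 1) ^ s)).toReal := by
  rw [mzv_eq_toReal, mzvBounded_cons]
  congr 1
  refine tsum_congr fun m => ?_
  rw [if_pos le_top, mzvBounded_natCast, ← ENNReal.ofReal_mul (by positivity)]
  congr 1
  push_cast
  ring

theorem ENNReal.tsum_ite_lt (w : ℕ → ENNReal) (n : ℕ) :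
    (∑' m, if n < m then w m else 0) = ∑' j, w (n + 1 + j) := by
  rw [← ENNReal.summable.sum_add_tsum_nat_add' (k := n + 1), Finset.sum_eq_zero, zero_add]
  · refine tsum_congr fun j => ?_
    rw [if_pos (by omega), add_comm]
  · intro m hm
    exact if_neg (by have := Finset.mem_range.1 hm; omega)

/-- Exchanging the two outermost summations, where the outermost one is weighted. -/
theorem tsum_weight_mul_mzvTrunc_cons (w w' : ℕ → ℝ) (hw : ∀ n, 0 ≤ w n)
    (h : ∀ n, HasSum (fun j : ℕ => w (n + 1 + j) / (((n + 1 + j : ℕ) : ℝ) + 1) ^ 2) (w' n))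
    (s : ℕ) (t : List ℕ) :
    (∑' m : ℕ, ENNReal.ofReal (w m * (mzvTrunc (s :: t) m / ((m : ℝ) + 1) ^ 2))) =
      ∑' n : ℕ, ENNReal.ofReal (w' n * (mzvTrunc t n / ((n : ℝ) + 1) ^ s)) := by
  have hf : ∀ n : ℕ, 0 ≤ mzvTrunc t n / ((n : ℝ) + 1) ^ s := fun n =>
    div_nonneg (mzvTrunc_nonneg t n) (by positivity)
  have h1 : ∀ m : ℕ, ENNReal.ofReal (w m * (mzvTrunc (s :: t) m / ((m : ℝ) + 1) ^ 2)) =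
      ∑' n : ℕ, if n < m then ENNReal.ofReal (w m / ((m : ℝ) + 1) ^ 2) *
        ENNReal.ofReal (mzvTrunc t n / ((n : ℝ) + 1) ^ s) else 0 := by
    intro m
    rw [mul_div_left_comm, mul_comm, ENNReal.ofReal_mul (div_nonneg (hw m) (by positivity)),
      mzvTrunc, ENNReal.ofReal_sum_of_nonneg fun n _ => hf n, Finset.mul_sum,
      tsum_eq_sum (s := Finset.range m) fun n hn => if_neg (by simpa using hn)]
    exact Finset.sum_congr rfl fun n hn => (if_pos (Finset.mem_range.1 hn)).symm
  simp_rw [h1]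
  rw [ENNReal.tsum_comm]
  refine tsum_congr fun n => ?_
  rw [ENNReal.tsum_ite_lt, ENNReal.tsum_mul_right, ← ENNReal.ofReal_tsum_of_nonneg
    (fun j => div_nonneg (hw _) (by positivity)) (h n).summable, (h n).tsum_eq,
    ENNReal.ofReal_mul ((h n).nonneg fun j => div_nonneg (hw _) (by positivity))]

/-- The normalised Wallis numbers `∏_{i < n} (2i + 1)/(2i + 2)`. -/
noncomputable def wallisRatio (n : ℕ) : ℝ :=
  ∏ i ∈ Finset.range n, (2 * (i : ℝ) + 1) / (2 * i + 2)

theorem wallisRatio_pos (n : ℕ) : 0 < wallisRatio n :=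
  Finset.prod_pos fun _ _ => by positivity

theorem wallisRatio_succ (n : ℕ) :
    wallisRatio (n + 1) * (2 * n + 2) = wallisRatio n * (2 * n + 1) := by
  unfold wallisRatio
  rw [Finset.prod_range_succ]
  field_simp

theorem one_div_succ_le_wallisRatio (n : ℕ) : 1 / ((n : ℝ) + 1) ≤ wallisRatio n := by
  induction n with
  | zero => simp [wallisRatio]
  | succ n ih =>
    have h : wallisRatio (n + 1) = wallisRatio n * ((2 * n + 1) / (2 * n + 2)) := by
      rw [mul_div_assoc', ← wallisRatio_succ, mul_div_cancel_right₀ _ (by positivity)]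
    rw [h]
    refine le_trans ?_ (mul_le_mul_of_nonneg_right ih (by positivity))
    push_cast
    rw [div_mul_div_comm, div_le_div_iff₀ (by positivity) (by positivity)]
    nlinarith [(Nat.cast_nonneg n : (0 : ℝ) ≤ n)]

/-- The moments of powers of the sine against `(π - 2x)^(2a)/(2a)!`. -/
noncomputable def sinMoment (a n : ℕ) : ℝ :=
  ∫ x in (0 : ℝ)..(Real.pi / 2), (Real.pi - 2 * x) ^ (2 * a) / (2 * a).factorial *
    Real.sin x ^ (2 * n)

/-- The normalised moments. -/
noncomputable def sinMomentRatio (a n : ℕ) : ℝ :=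
  sinMoment a n / (Real.pi / 2 * wallisRatio n)

theorem sinMoment_zero (n : ℕ) : sinMoment 0 n = Real.pi / 2 * wallisRatio n := by
  unfold sinMoment
  simp only [mul_zero, pow_zero, Nat.factorial_zero, Nat.cast_one, div_one, one_mul]
  induction n with
  | zero => simp [wallisRatio]
  | succ n ih =>
    have h := integral_sin_pow (a := 0) (b := Real.pi / 2) (2 * n)
    rw [show 2 * (n + 1) = 2 * n + 2 by ring, h, ih]
    have h2 := wallisRatio_succ n
    simp only [Real.sin_zero, Real.cos_pi_div_two, mul_zero]
    rw [zero_pow (by omega)]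
    push_cast
    field_simp
    linear_combination -Real.pi * h2

theorem sinMomentRatio_zero (n : ℕ) : sinMomentRatio 0 n = 1 := by
  unfold sinMomentRatio
  rw [sinMoment_zero]
  have := wallisRatio_pos n
  have := Real.pi_pos
  exact div_self (by positivity)

theorem hasDerivAt_pi_sub_pow (k : ℕ) (x : ℝ) :
    HasDerivAt (fun x => (Real.pi - 2 * x) ^ (k + 1) / (k + 1).factorial)
      (-2 * ((Real.pi - 2 * x) ^ k / k.factorial)) x := by
  have h1 : HasDerivAt (fun x : ℝ => Real.pi - 2 * x) (-2) x := by
    simpa using ((hasDerivAt_id x).const_mul 2).const_sub Real.pi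
  refine ((h1.pow (k + 1)).div_const _).congr_deriv ?_
  rw [Nat.factorial_succ]
  push_cast
  field_simp

theorem hasDerivAt_sin_pow (k : ℕ) (x : ℝ) :
    HasDerivAt (fun x => Real.sin x ^ (k + 1)) ((k + 1) * Real.sin x ^ k * Real.cos x) x := by
  refine ((Real.hasDerivAt_sin x).pow (k + 1)).congr_deriv ?_
  push_cast
  simp only

theorem hasDerivAt_sin_pow_mul_cos (k : ℕ) (x : ℝ) :
    HasDerivAt (fun x => ((k : ℝ) + 2) * Real.sin x ^ (k + 1) * Real.cos x)
      ((k + 2) * (k + 1) * Real.sin x ^ k - (k + 2) ^ 2 * Real.sin x ^ (k + 2)) x := by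
  refine (((hasDerivAt_sin_pow k x).const_mul ((k : ℝ) + 2)).mul
    (Real.hasDerivAt_cos x)).congr_deriv ?_
  have := Real.sin_sq_add_cos_sq x
  linear_combination ((k + 2) * (k + 1) * Real.sin x ^ k) * this

theorem sinMoment_succ (a n : ℕ) :
    (2 * n + 2) * (2 * n + 1) * sinMoment (a + 1) n -
      (2 * n + 2) ^ 2 * sinMoment (a + 1) (n + 1) = 4 * sinMoment a (n + 1) := by
  unfold sinMoment
  have hd : ∀ x : ℝ, HasDerivAt
      (fun x => (Real.pi - 2 * x) ^ (2 * a + 1 + 1) / (2 * a + 1 + 1).factorial *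
          ((((2 * n : ℕ) : ℝ) + 2) * Real.sin x ^ (2 * n + 1) * Real.cos x) +
        2 * ((Real.pi - 2 * x) ^ (2 * a + 1) / (2 * a + 1).factorial *
          Real.sin x ^ (2 * n + 1 + 1)))
      ((2 * n + 2) * (2 * n + 1) * ((Real.pi - 2 * x) ^ (2 * (a + 1)) /
          (2 * (a + 1)).factorial * Real.sin x ^ (2 * n)) -
        (2 * n + 2) ^ 2 * ((Real.pi - 2 * x) ^ (2 * (a + 1)) /
          (2 * (a + 1)).factorial * Real.sin x ^ (2 * (n + 1))) -
        4 * ((Real.pi - 2 * x) ^ (2 * a) / (2 * a).factorial * Real.sin x ^ (2 * (n + 1)))) x := by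
    intro x
    refine (((hasDerivAt_pi_sub_pow (2 * a + 1) x).mul
      (hasDerivAt_sin_pow_mul_cos (2 * n) x)).add
      (((hasDerivAt_pi_sub_pow (2 * a) x).mul
        (hasDerivAt_sin_pow (2 * n + 1) x)).const_mul 2)).congr_deriv ?_
    push_cast
    rw [show 2 * (a + 1) = 2 * a + 1 + 1 by ring, show 2 * (n + 1) = 2 * n + 2 by ring]
    ring
  have hfund := intervalIntegral.integral_eq_sub_of_hasDerivAt (a := 0) (b := Real.pi / 2)
    (fun x _ => hd x) (Continuous.intervalIntegrable (by fun_prop) _ _)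
  have hpi : Real.pi - 2 * (Real.pi / 2) = 0 := by ring
  rw [intervalIntegral.integral_sub, intervalIntegral.integral_sub,
    intervalIntegral.integral_const_mul, intervalIntegral.integral_const_mul,
    intervalIntegral.integral_const_mul, hpi] at hfund
  · simp at hfund
    linarith
  all_goals exact Continuous.intervalIntegrable (by fun_prop) _ _

theorem sinMomentRatio_sub (a n : ℕ) :
    sinMomentRatio (a + 1) n - sinMomentRatio (a + 1) (n + 1) =
      sinMomentRatio a (n + 1) / ((n : ℝ) + 1) ^ 2 := by
  have h := sinMoment_succ a n
  have h2 := wallisRatio_succ n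
  have h3 := (wallisRatio_pos n).ne'
  have h4 := (wallisRatio_pos (n + 1)).ne'
  have h5 := Real.pi_ne_zero
  unfold sinMomentRatio
  field_simp
  linear_combination (wallisRatio n / 4) * h +
    ((n : ℝ) + 1) / 2 * sinMoment (a + 1) n * h2

theorem sinMoment_nonneg (a n : ℕ) : 0 ≤ sinMoment a n := by
  have hpi := Real.pi_pos
  refine intervalIntegral.integral_nonneg (by positivity) fun x _ => ?_
  have h1 : 0 ≤ (Real.pi - 2 * x) ^ (2 * a) := (even_two_mul a).pow_nonneg _
  have h2 : 0 ≤ Real.sin x ^ (2 * n) := (even_two_mul n).pow_nonneg _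
  positivity

theorem sinMomentRatio_nonneg (a n : ℕ) : 0 ≤ sinMomentRatio a n := by
  have := Real.pi_pos
  have := wallisRatio_pos n
  exact div_nonneg (sinMoment_nonneg a n) (by positivity)

theorem sinMoment_succ_le (a n : ℕ) :
    sinMoment (a + 1) n ≤ Real.pi ^ (2 * (a + 1)) * (sinMoment 0 n - sinMoment 0 (n + 1)) := by
  have hpi := Real.pi_pos
  unfold sinMoment
  rw [← intervalIntegral.integral_sub (Continuous.intervalIntegrable (by fun_prop) _ _)
    (Continuous.intervalIntegrable (by fun_prop) _ _), ← intervalIntegral.integral_const_mul]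
  refine intervalIntegral.integral_mono_on (by positivity)
    (Continuous.intervalIntegrable (by fun_prop) _ _)
    (Continuous.intervalIntegrable (by fun_prop) _ _) fun x hx => ?_
  have hs : 0 ≤ Real.sin x ^ (2 * n) := (even_two_mul n).pow_nonneg _
  have hc : 0 ≤ Real.cos x := Real.cos_nonneg_of_neg_pi_div_two_le_of_le (by linarith [hx.1]) hx.2
  have hcos : Real.pi - 2 * x ≤ Real.pi * Real.cos x := by
    have := Real.one_sub_mul_le_cos hx.1 hx.2
    have h2 := mul_le_mul_of_nonneg_left this hpi.le
    refine le_trans (le_of_eq ?_) h2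
    field_simp
  have h1 : (Real.pi - 2 * x) ^ (2 * (a + 1)) ≤ Real.pi ^ (2 * (a + 1)) * Real.cos x ^ 2 := by
    calc (Real.pi - 2 * x) ^ (2 * (a + 1)) ≤ (Real.pi * Real.cos x) ^ (2 * (a + 1)) :=
          pow_le_pow_left₀ (by linarith [hx.2]) hcos _
      _ = Real.pi ^ (2 * (a + 1)) * Real.cos x ^ (2 * (a + 1)) := mul_pow _ _ _
      _ ≤ _ := by
        gcongr ?_ * ?_
        exact pow_le_pow_of_le_one hc (Real.cos_le_one x) (by omega)
  have h2 : (Real.pi - 2 * x) ^ (2 * (a + 1)) / ((2 * (a + 1)).factorial : ℝ) ≤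
      (Real.pi - 2 * x) ^ (2 * (a + 1)) :=
    div_le_self ((even_two_mul _).pow_nonneg _) (by exact_mod_cast Nat.factorial_pos _)
  calc _ ≤ Real.pi ^ (2 * (a + 1)) * Real.cos x ^ 2 * Real.sin x ^ (2 * n) := by
        gcongr
        exact h2.trans h1
    _ = _ := by
      rw [Real.cos_sq']
      simp
      ring

theorem tendsto_sinMomentRatio (a : ℕ) :
    Filter.Tendsto (sinMomentRatio (a + 1)) Filter.atTop (nhds 0) := by
  have hpi := Real.pi_pos
  have h : ∀ n : ℕ, sinMomentRatio (a + 1) n ≤ Real.pi ^ (2 * (a + 1)) * (1 / ((n : ℝ) + 1)) := by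
    intro n
    have h1 := sinMoment_succ_le a n
    have hw := wallisRatio_pos n
    rw [sinMoment_zero, sinMoment_zero] at h1
    unfold sinMomentRatio
    rw [div_le_iff₀ (by positivity)]
    refine h1.trans ?_
    have h2 := wallisRatio_succ n
    rw [mul_assoc]
    gcongr
    rw [← mul_sub, mul_left_comm]
    gcongr
    rw [one_div_mul_eq_div, le_div_iff₀ (by positivity)]
    nlinarith [(Nat.cast_nonneg n : (0 : ℝ) ≤ n)]
  refine squeeze_zero (fun n => sinMomentRatio_nonneg _ n) h ?_
  simpa only [mul_zero] using (tendsto_one_div_add_atTop_nhds_zero_nat (𝕜 := ℝ)).const_mul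
    (Real.pi ^ (2 * (a + 1)))

theorem hasSum_sinMomentRatio (a n : ℕ) :
    HasSum (fun j : ℕ => sinMomentRatio a (n + 1 + j) / ((n + j : ℕ) + 1 : ℝ) ^ 2)
      (sinMomentRatio (a + 1) n) := by
  rw [hasSum_iff_tendsto_nat_of_nonneg
    fun j => div_nonneg (sinMomentRatio_nonneg _ _) (by positivity)]
  have h : ∀ J, ∑ j ∈ Finset.range J, sinMomentRatio a (n + 1 + j) / ((n + j : ℕ) + 1 : ℝ) ^ 2 =
      sinMomentRatio (a + 1) n - sinMomentRatio (a + 1) (J + n) := by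
    intro J
    induction J with
    | zero => simp
    | succ J ih =>
      rw [Finset.sum_range_succ, ih, show n + 1 + J = n + J + 1 by ring,
        ← sinMomentRatio_sub a (n + J), add_comm n J, show J + 1 + n = J + n + 1 by ring]
      ring
  simp_rw [h]
  simpa only [sub_zero, Function.comp_def] using
    ((tendsto_sinMomentRatio a).comp (Filter.tendsto_add_atTop_nat n)).const_sub
      (sinMomentRatio (a + 1) n)

theorem nonneg_of_second_deriv_nonneg {f f' f'' : ℝ → ℝ} {c : ℝ}
    (h1 : ∀ x, HasDerivAt f (f' x) x) (h2 : ∀ x, HasDerivAt f' (f'' x) x)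
    (h3 : f 0 = 0) (h4 : f' 0 = 0) (h5 : ∀ x ∈ Set.Icc 0 c, 0 ≤ f'' x) :
    ∀ x ∈ Set.Icc 0 c, 0 ≤ f x := by
  have key : ∀ g g' : ℝ → ℝ, (∀ x, HasDerivAt g (g' x) x) → g 0 = 0 →
      (∀ x ∈ Set.Icc 0 c, 0 ≤ g' x) → ∀ x ∈ Set.Icc 0 c, 0 ≤ g x := by
    intro g g' hg h0 hg' x hx
    have hmono : MonotoneOn g (Set.Icc 0 c) := by
      refine monotoneOn_of_deriv_nonneg (convex_Icc 0 c)
        (fun y _ => (hg y).continuousAt.continuousWithinAt)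
        (fun y _ => (hg y).differentiableAt.differentiableWithinAt) fun y hy => ?_
      rw [(hg y).deriv]
      exact hg' y (interior_subset hy)
    have := hmono ⟨le_rfl, hx.1.trans hx.2⟩ hx hx.1
    rwa [h0] at this
  exact key f f' h1 h3 (key f' f'' h2 h4 h5)

/-- The truncated multiple zeta value of `(2, …, 2)`. -/
noncomputable def zetaTwos (b n : ℕ) : ℝ := mzvTrunc (List.replicate b 2) n

theorem zetaTwos_zero (n : ℕ) : zetaTwos 0 n = 1 := rfl

theorem zetaTwos_succ (b n : ℕ) :
    zetaTwos (b + 1) n = ∑ m ∈ Finset.range n, zetaTwos b m / ((m : ℝ) + 1) ^ 2 := rfl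

theorem zetaTwos_nonneg (b n : ℕ) : 0 ≤ zetaTwos b n := mzvTrunc_nonneg _ _

theorem zetaTwos_le_pow (b n : ℕ) : zetaTwos b n ≤ (n : ℝ) ^ b := by
  induction b generalizing n with
  | zero => simp [zetaTwos_zero]
  | succ b ih =>
    rw [zetaTwos_succ]
    have h : ∀ m ∈ Finset.range n, zetaTwos b m / ((m : ℝ) + 1) ^ 2 ≤ (n : ℝ) ^ b := by
      intro m hm
      have hm' : (m : ℝ) ≤ n := by exact_mod_cast (Finset.mem_range.1 hm).le
      refine (div_le_self (zetaTwos_nonneg b m) ?_).trans ((ih m).trans (by gcongr))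
      exact one_le_pow₀ (by linarith [(Nat.cast_nonneg m : (0 : ℝ) ≤ m)])
    refine (Finset.sum_le_sum h).trans (le_of_eq ?_)
    rw [Finset.sum_const, Finset.card_range, nsmul_eq_mul, pow_succ, mul_comm]

/-- The partial sums of the expansion of `(2x)^(2b+2)/(2b+2)!` in even powers of the sine. -/
noncomputable def sinSeries (b N : ℕ) (x : ℝ) : ℝ :=
  ∑ n ∈ Finset.range N, zetaTwos b n / (wallisRatio (n + 1) * ((n : ℝ) + 1) ^ 2) *
    Real.sin x ^ (2 * n + 1 + 1)

/-- The error of the expansion of `(2x)^(2b)/(2b)!` in even powers of the sine. -/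
noncomputable def sinError : ℕ → ℕ → ℝ → ℝ
  | 0, _, _ => 0
  | b + 1, N, x => (2 * x) ^ (2 * b + 1 + 1) / (2 * b + 1 + 1).factorial - sinSeries b N x

theorem hasDerivAt_two_mul_pow (k : ℕ) (x : ℝ) :
    HasDerivAt (fun x : ℝ => (2 * x) ^ (k + 1) / (k + 1).factorial)
      (2 * ((2 * x) ^ k / k.factorial)) x := by
  have h1 : HasDerivAt (fun x : ℝ => 2 * x) 2 x := by
    simpa using (hasDerivAt_id x).const_mul (2 : ℝ)
  refine ((h1.pow (k + 1)).div_const _).congr_deriv ?_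
  rw [Nat.factorial_succ]
  push_cast
  field_simp

theorem sum_zetaTwos_mul_sub (b N : ℕ) (x : ℝ) :
    ∑ n ∈ Finset.range N, zetaTwos b n * (Real.sin x ^ (2 * n) / wallisRatio n -
      Real.sin x ^ (2 * n + 2) / wallisRatio (n + 1)) =
      (2 * x) ^ (2 * b) / (2 * b).factorial - sinError b N x -
        zetaTwos b N * (Real.sin x ^ (2 * N) / wallisRatio N) := by
  have h2 : ∀ n, Real.sin x ^ (2 * (n + 1)) = Real.sin x ^ (2 * n + 2) := fun n => by ring_nf
  cases b with
  | zero =>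
    simp only [zetaTwos_zero, one_mul, sinError]
    induction N with
    | zero => simp [wallisRatio]
    | succ N ih => rw [Finset.sum_range_succ, ih, h2]; ring
  | succ b =>
    have h : (2 * x) ^ (2 * (b + 1)) / ((2 * (b + 1)).factorial : ℝ) - sinError (b + 1) N x =
        sinSeries b N x := by
      rw [sinError, show 2 * (b + 1) = 2 * b + 1 + 1 by ring]; ring
    rw [h]
    clear h
    unfold sinSeries
    induction N with
    | zero => simp [zetaTwos_succ]
    | succ N ih =>
      have h1 : zetaTwos (b + 1) (N + 1) =
          zetaTwos (b + 1) N + zetaTwos b N / ((N : ℝ) + 1) ^ 2 := by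
        rw [zetaTwos_succ, Finset.sum_range_succ, ← zetaTwos_succ]
      rw [Finset.sum_range_succ, ih, Finset.sum_range_succ, h1, h2]
      have h3 := (wallisRatio_pos N).ne'
      have h4 := (wallisRatio_pos (N + 1)).ne'
      field_simp
      ring

/-- The derivative of `sinError (b + 1) N`. -/
noncomputable def sinErrorDeriv (b N : ℕ) (x : ℝ) : ℝ :=
  2 * ((2 * x) ^ (2 * b + 1) / (2 * b + 1).factorial) -
    ∑ n ∈ Finset.range N, zetaTwos b n / (wallisRatio (n + 1) * ((n : ℝ) + 1) ^ 2) *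
      (((2 * n : ℕ) + 2 : ℝ) * Real.sin x ^ (2 * n + 1) * Real.cos x)

theorem hasDerivAt_sinError (b N : ℕ) (x : ℝ) :
    HasDerivAt (sinError (b + 1) N) (sinErrorDeriv b N x) x := by
  refine (hasDerivAt_two_mul_pow (2 * b + 1) x).sub (HasDerivAt.fun_sum fun n _ => ?_)
  refine ((hasDerivAt_sin_pow (2 * n + 1) x).const_mul _).congr_deriv ?_
  push_cast
  ring

theorem hasDerivAt_sinErrorDeriv (b N : ℕ) (x : ℝ) :
    HasDerivAt (sinErrorDeriv b N)
      (4 * (sinError b N x + zetaTwos b N * (Real.sin x ^ (2 * N) / wallisRatio N))) x := by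
  have h := sum_zetaTwos_mul_sub b N x
  refine (((hasDerivAt_two_mul_pow (2 * b) x).const_mul 2).sub
    (HasDerivAt.fun_sum fun n _ => (hasDerivAt_sin_pow_mul_cos (2 * n) x).const_mul
      (zetaTwos b n / (wallisRatio (n + 1) * ((n : ℝ) + 1) ^ 2)))).congr_deriv ?_
  have h2 : ∑ n ∈ Finset.range N, zetaTwos b n / (wallisRatio (n + 1) * ((n : ℝ) + 1) ^ 2) *
      ((((2 * n : ℕ) : ℝ) + 2) * ((2 * n : ℕ) + 1) * Real.sin x ^ (2 * n) -
        ((2 * n : ℕ) + 2) ^ 2 * Real.sin x ^ (2 * n + 2)) =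
      4 * ∑ n ∈ Finset.range N, zetaTwos b n * (Real.sin x ^ (2 * n) / wallisRatio n -
        Real.sin x ^ (2 * n + 2) / wallisRatio (n + 1)) := by
    rw [Finset.mul_sum]
    refine Finset.sum_congr rfl fun n _ => ?_
    have h3 := (wallisRatio_pos n).ne'
    have h4 := (wallisRatio_pos (n + 1)).ne'
    have h5 := wallisRatio_succ n
    push_cast
    field_simp
    linear_combination (-2 * zetaTwos b n * Real.sin x ^ (2 * n)) * h5
  rw [h2, h]
  ring

theorem sinError_zero (b N : ℕ) : sinError b N 0 = 0 := by
  cases b <;> simp [sinError, sinSeries]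

theorem sinErrorDeriv_zero (b N : ℕ) : sinErrorDeriv b N 0 = 0 := by
  simp [sinErrorDeriv]

theorem sin_pow_div_wallisRatio_nonneg (N : ℕ) (x : ℝ) :
    0 ≤ Real.sin x ^ (2 * N) / wallisRatio N :=
  div_nonneg ((even_two_mul N).pow_nonneg _) (wallisRatio_pos N).le

theorem sinError_nonneg (b N : ℕ) (c : ℝ) : ∀ x ∈ Set.Icc 0 c, 0 ≤ sinError b N x := by
  induction b with
  | zero => exact fun _ _ => le_rfl
  | succ b ih =>
    exact nonneg_of_second_deriv_nonneg (hasDerivAt_sinError b N) (hasDerivAt_sinErrorDeriv b N)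
      (sinError_zero _ _) (sinErrorDeriv_zero _ _) fun x hx => mul_nonneg (by norm_num)
        (add_nonneg (ih x hx) (mul_nonneg (zetaTwos_nonneg _ _)
          (sin_pow_div_wallisRatio_nonneg N x)))

theorem tendsto_zetaTwos_mul_sin_pow (b : ℕ) {c : ℝ} (h0 : 0 ≤ c) (h1 : c < Real.pi / 2) :
    Filter.Tendsto (fun N => zetaTwos b N * (Real.sin c ^ (2 * N) / wallisRatio N))
      Filter.atTop (nhds 0) := by
  have hs0 : 0 ≤ Real.sin c := Real.sin_nonneg_of_nonneg_of_le_pi h0 (by linarith [Real.pi_pos])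
  have hs1 : Real.sin c < 1 := by
    rw [← Real.sin_pi_div_two]
    exact Real.sin_lt_sin_of_lt_of_le_pi_div_two (by linarith [Real.pi_pos]) le_rfl h1
  have hq : |Real.sin c ^ 2| < 1 := by
    rw [abs_of_nonneg (sq_nonneg _)]; nlinarith
  have e1 := tendsto_pow_const_mul_const_pow_of_abs_lt_one (b + 1) hq
  have e2 := tendsto_pow_const_mul_const_pow_of_abs_lt_one b hq
  refine squeeze_zero (fun N => mul_nonneg (zetaTwos_nonneg _ _)
    (sin_pow_div_wallisRatio_nonneg N c)) (fun N => ?_) (by simpa using e1.add e2)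
  have h2 := one_div_succ_le_wallisRatio N
  have h3 := wallisRatio_pos N
  have h4 : Real.sin c ^ (2 * N) / wallisRatio N ≤ (Real.sin c ^ 2) ^ N * (N + 1) := by
    rw [div_le_iff₀ h3, pow_mul]
    have h5 : 1 ≤ ((N : ℝ) + 1) * wallisRatio N := by
      rw [div_le_iff₀ (by positivity)] at h2; linarith
    rw [mul_assoc]
    exact le_mul_of_one_le_right (by positivity) h5
  calc _ ≤ (N : ℝ) ^ b * ((Real.sin c ^ 2) ^ N * (N + 1)) :=
        mul_le_mul (zetaTwos_le_pow b N) h4 (sin_pow_div_wallisRatio_nonneg N c) (by positivity)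
    _ = _ := by ring

theorem exists_sinError_le (b : ℕ) {c : ℝ} (h0 : 0 ≤ c) (h1 : c < Real.pi / 2) :
    ∃ K : ℕ → ℝ, Filter.Tendsto K Filter.atTop (nhds 0) ∧
      ∀ N, ∀ x ∈ Set.Icc 0 c, sinError b N x ≤ K N := by
  induction b with
  | zero => exact ⟨fun _ => 0, tendsto_const_nhds, fun _ _ _ => le_rfl⟩
  | succ b ih =>
    obtain ⟨K, hK, hle⟩ := ih
    refine ⟨fun N => 2 * (K N + zetaTwos b N * (Real.sin c ^ (2 * N) / wallisRatio N)) * c ^ 2,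
      ?_, fun N => ?_⟩
    · simpa using ((hK.add (tendsto_zetaTwos_mul_sin_pow b h0 h1)).const_mul 2).mul_const (c ^ 2)
    · set M := K N + zetaTwos b N * (Real.sin c ^ (2 * N) / wallisRatio N) with hM
      have hsin : ∀ x ∈ Set.Icc 0 c, sinError b N x +
          zetaTwos b N * (Real.sin x ^ (2 * N) / wallisRatio N) ≤ M := by
        intro x hx
        have hz := zetaTwos_nonneg b N
        have hw := wallisRatio_pos N
        have hs0 : 0 ≤ Real.sin x :=
          Real.sin_nonneg_of_nonneg_of_le_pi hx.1 (by linarith [Real.pi_pos, hx.2])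
        have hs1 : Real.sin x ≤ Real.sin c :=
          Real.sin_le_sin_of_le_of_le_pi_div_two (by linarith [Real.pi_pos, hx.1]) h1.le hx.2
        have := hle N x hx
        rw [hM]
        gcongr
      have hM0 : 0 ≤ M := by
        refine le_trans (add_nonneg (sinError_nonneg b N c 0 ⟨le_rfl, h0⟩) (mul_nonneg
          (zetaTwos_nonneg _ _) (sin_pow_div_wallisRatio_nonneg N 0))) (hsin 0 ⟨le_rfl, h0⟩)
      have key := nonneg_of_second_deriv_nonneg (c := c)
        (f := fun x => 2 * M * x ^ 2 - sinError (b + 1) N x)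
        (f' := fun x => 4 * M * x - sinErrorDeriv b N x)
        (f'' := fun x => 4 * M - (4 * (sinError b N x +
          zetaTwos b N * (Real.sin x ^ (2 * N) / wallisRatio N))))
        (fun x => ((((hasDerivAt_pow 2 x).const_mul (2 * M)).sub
          (hasDerivAt_sinError b N x))).congr_deriv (by push_cast; ring))
        (fun x => ((((hasDerivAt_id x).const_mul (4 * M)).sub
          (hasDerivAt_sinErrorDeriv b N x))).congr_deriv (by ring))
        (by simp [sinError_zero]) (by simp [sinErrorDeriv_zero])
        (fun x hx => by linarith [hsin x hx])
      intro x hx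
      have h2 := key x hx
      have h3 : x ^ 2 ≤ c ^ 2 := by
        have := hx.1
        have := hx.2
        gcongr
      nlinarith

theorem tendsto_sinSeries (b : ℕ) {x : ℝ} (h0 : 0 ≤ x) (h1 : x < Real.pi / 2) :
    Filter.Tendsto (fun N => sinSeries b N x) Filter.atTop
      (nhds ((2 * x) ^ (2 * b + 2) / (2 * b + 2).factorial)) := by
  obtain ⟨K, hK, hle⟩ := exists_sinError_le (b + 1) h0 h1
  have h2 := squeeze_zero (fun N => sinError_nonneg (b + 1) N x x ⟨h0, le_rfl⟩)
    (fun N => hle N x ⟨h0, le_rfl⟩) hK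
  have h3 := h2.const_sub ((2 * x) ^ (2 * b + 2) / (2 * b + 2).factorial)
  rw [sub_zero] at h3
  exact h3.congr fun N => by rw [sinError]; ring

theorem sinSeries_nonneg (b N : ℕ) (x : ℝ) : 0 ≤ sinSeries b N x :=
  Finset.sum_nonneg fun n _ => mul_nonneg (div_nonneg (zetaTwos_nonneg _ _)
    (mul_nonneg (wallisRatio_pos _).le (by positivity)))
    (Even.pow_nonneg ⟨n + 1, by ring⟩ _)

theorem sinSeries_le (b N : ℕ) {x : ℝ} (h0 : 0 ≤ x) :
    sinSeries b N x ≤ (2 * x) ^ (2 * b + 2) / (2 * b + 2).factorial :=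
  sub_nonneg.1 (sinError_nonneg (b + 1) N x x ⟨h0, le_rfl⟩)

theorem integral_pi_sub_pow_mul_sin_pow_mul_cos (a n : ℕ) :
    ∫ x in (0 : ℝ)..(Real.pi / 2), (Real.pi - 2 * x) ^ (2 * a + 1) / (2 * a + 1).factorial *
      (Real.sin x ^ (2 * n + 1) * Real.cos x) = sinMoment a (n + 1) / (n + 1) := by
  unfold sinMoment
  have hd : ∀ x : ℝ, HasDerivAt
      (fun x => (Real.pi - 2 * x) ^ (2 * a + 1) / (2 * a + 1).factorial *
          Real.sin x ^ (2 * n + 1 + 1))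
      ((2 * n + 2) * ((Real.pi - 2 * x) ^ (2 * a + 1) / (2 * a + 1).factorial *
          (Real.sin x ^ (2 * n + 1) * Real.cos x)) -
        2 * ((Real.pi - 2 * x) ^ (2 * a) / (2 * a).factorial * Real.sin x ^ (2 * (n + 1)))) x := by
    intro x
    refine ((hasDerivAt_pi_sub_pow (2 * a) x).mul (hasDerivAt_sin_pow (2 * n + 1) x)).congr_deriv ?_
    push_cast
    rw [show 2 * (n + 1) = 2 * n + 1 + 1 by ring]
    ring
  have hfund := intervalIntegral.integral_eq_sub_of_hasDerivAt (a := 0) (b := Real.pi / 2)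
    (fun x _ => hd x) (Continuous.intervalIntegrable (by fun_prop) _ _)
  have hpi : Real.pi - 2 * (Real.pi / 2) = 0 := by ring
  rw [intervalIntegral.integral_sub (Continuous.intervalIntegrable (by fun_prop) _ _)
    (Continuous.intervalIntegrable (by fun_prop) _ _),
    intervalIntegral.integral_const_mul, intervalIntegral.integral_const_mul, hpi] at hfund
  rw [eq_div_iff (by positivity)]
  simp at hfund
  linarith

/-- The kernel `(π - 2x)^(2a+1) cot x / (2a+1)!`. -/
noncomputable def cotKernel (a : ℕ) (x : ℝ) : ℝ :=
  (Real.pi - 2 * x) ^ (2 * a + 1) / (2 * a + 1).factorial * (Real.cos x / Real.sin x)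

theorem integral_cotKernel_mul_sinSeries (a b N : ℕ) :
    ∫ x in (0 : ℝ)..(Real.pi / 2), cotKernel a x * sinSeries b N x =
      Real.pi / 2 * ∑ n ∈ Finset.range N,
        sinMomentRatio a (n + 1) * (zetaTwos b n / ((n : ℝ) + 1) ^ 3) := by
  have h : ∀ x, cotKernel a x * sinSeries b N x = ∑ n ∈ Finset.range N,
      zetaTwos b n / (wallisRatio (n + 1) * ((n : ℝ) + 1) ^ 2) *
        ((Real.pi - 2 * x) ^ (2 * a + 1) / (2 * a + 1).factorial *
          (Real.sin x ^ (2 * n + 1) * Real.cos x)) := by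
    intro x
    unfold cotKernel sinSeries
    rw [Finset.mul_sum]
    refine Finset.sum_congr rfl fun n _ => ?_
    rw [pow_succ (Real.sin x) (2 * n + 1)]
    rcases eq_or_ne (Real.sin x) 0 with hs | hs
    · simp [hs]
    · field_simp
  simp_rw [h]
  rw [intervalIntegral.integral_finsetSum
    fun n _ => Continuous.intervalIntegrable (by fun_prop) _ _, Finset.mul_sum]
  refine Finset.sum_congr rfl fun n _ => ?_
  rw [intervalIntegral.integral_const_mul, integral_pi_sub_pow_mul_sin_pow_mul_cos]
  have h4 := (wallisRatio_pos (n + 1)).ne'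
  have h5 := Real.pi_ne_zero
  unfold sinMomentRatio
  field_simp

theorem cotKernel_nonneg (a : ℕ) {x : ℝ} (h0 : 0 ≤ x) (h1 : x ≤ Real.pi / 2) :
    0 ≤ cotKernel a x := by
  have hpi := Real.pi_pos
  have hc := Real.cos_nonneg_of_neg_pi_div_two_le_of_le (x := x) (by linarith) h1
  have hs := Real.sin_nonneg_of_nonneg_of_le_pi h0 (by linarith)
  have h2 : 0 ≤ Real.pi - 2 * x := by linarith
  unfold cotKernel
  positivity

theorem cotKernel_mul_le (a b : ℕ) {x : ℝ} (h0 : 0 ≤ x) (h1 : x ≤ Real.pi / 2) :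
    cotKernel a x * ((2 * x) ^ (2 * b + 2) / (2 * b + 2).factorial) ≤
      Real.pi ^ (2 * a + 1) * Real.pi ^ (2 * b + 2) := by
  have hpi := Real.pi_pos
  have hc := Real.cos_nonneg_of_neg_pi_div_two_le_of_le (x := x) (by linarith) h1
  have hs := Real.sin_nonneg_of_nonneg_of_le_pi h0 (by linarith)
  have hsin := Real.mul_le_sin h0 h1
  have h2 : 0 ≤ Real.pi - 2 * x := by linarith
  have e1 : (Real.pi - 2 * x) ^ (2 * a + 1) / ((2 * a + 1).factorial : ℝ) ≤
      Real.pi ^ (2 * a + 1) := by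
    refine (div_le_self (by positivity) (by exact_mod_cast Nat.factorial_pos _)).trans ?_
    gcongr
    linarith
  have e2 : (2 * x) ^ (2 * b + 2) / ((2 * b + 2).factorial : ℝ) ≤
      Real.pi ^ (2 * b + 1) * (2 * x) := by
    refine (div_le_self (by positivity) (by exact_mod_cast Nat.factorial_pos _)).trans ?_
    rw [pow_succ]
    gcongr
    linarith
  have e3 : Real.cos x / Real.sin x * (2 * x) ≤ Real.pi := by
    rcases hs.eq_or_lt with hs | hs
    · rw [← hs]; simp [hpi.le]
    · rw [div_mul_eq_mul_div, div_le_iff₀ hs]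
      have : 2 * x ≤ Real.pi * Real.sin x := by
        rw [div_mul_eq_mul_div, div_le_iff₀ hpi] at hsin; linarith
      nlinarith [Real.cos_le_one x]
  calc cotKernel a x * ((2 * x) ^ (2 * b + 2) / (2 * b + 2).factorial)
      ≤ Real.pi ^ (2 * a + 1) * (Real.cos x / Real.sin x) *
        (Real.pi ^ (2 * b + 1) * (2 * x)) := by
        unfold cotKernel
        gcongr
    _ = Real.pi ^ (2 * a + 1) * Real.pi ^ (2 * b + 1) *
        (Real.cos x / Real.sin x * (2 * x)) := by ring
    _ ≤ Real.pi ^ (2 * a + 1) * Real.pi ^ (2 * b + 1) * Real.pi := by gcongr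
    _ = _ := by ring

theorem measurable_cotKernel (a : ℕ) : Measurable (cotKernel a) := by
  unfold cotKernel
  fun_prop

theorem hasSum_sinMomentRatio_mul_zetaTwos (a b : ℕ) :
    HasSum (fun n : ℕ => sinMomentRatio a (n + 1) * (zetaTwos b n / ((n : ℝ) + 1) ^ 3))
      (2 / Real.pi * ∫ x in (0 : ℝ)..(Real.pi / 2),
        cotKernel a x * ((2 * x) ^ (2 * b + 2) / (2 * b + 2).factorial)) := by
  have hpi := Real.pi_pos
  rw [hasSum_iff_tendsto_nat_of_nonneg fun n =>
    mul_nonneg (sinMomentRatio_nonneg _ _) (div_nonneg (zetaTwos_nonneg _ _) (by positivity))]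
  have h : ∀ N, ∑ n ∈ Finset.range N,
      sinMomentRatio a (n + 1) * (zetaTwos b n / ((n : ℝ) + 1) ^ 3) =
      2 / Real.pi * ∫ x in (0 : ℝ)..(Real.pi / 2), cotKernel a x * sinSeries b N x := by
    intro N
    rw [integral_cotKernel_mul_sinSeries]
    field_simp
  simp_rw [h]
  refine Filter.Tendsto.const_mul _ ?_
  refine intervalIntegral.tendsto_integral_filter_of_dominated_convergence
    (fun _ => Real.pi ^ (2 * a + 1) * Real.pi ^ (2 * b + 2)) ?_ ?_ (by simp) ?_
  · refine Filter.Eventually.of_forall fun N => Measurable.aestronglyMeasurable ?_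
    have := measurable_cotKernel a
    unfold sinSeries
    fun_prop
  · refine Filter.Eventually.of_forall fun N => Filter.Eventually.of_forall fun x hx => ?_
    rw [Set.uIoc_of_le (by positivity)] at hx
    have h1 := cotKernel_nonneg a hx.1.le hx.2
    rw [Real.norm_of_nonneg (mul_nonneg h1 (sinSeries_nonneg _ _ _))]
    exact (mul_le_mul_of_nonneg_left (sinSeries_le b N hx.1.le) h1).trans
      (cotKernel_mul_le a b hx.1.le hx.2)
  · refine Filter.Eventually.of_forall fun x hx => ?_
    rw [Set.uIoc_of_le (by positivity)] at hx
    rcases hx.2.eq_or_lt with h1 | h1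
    · have : cotKernel a x = 0 := by simp [cotKernel, h1]
      simp [this]
    · exact (tendsto_sinSeries b hx.1.le h1).const_mul _

theorem sum_two_mul_sin_mul_sin (N : ℕ) (x : ℝ) :
    (∑ n ∈ Finset.range N, 2 * Real.sin (2 * ((n : ℝ) + 1) * x)) * Real.sin x
      = Real.cos x - Real.cos ((2 * N + 1) * x) := by
  induction N with
  | zero => simp
  | succ N ih =>
    rw [Finset.sum_range_succ, add_mul, ih]
    have h1 : ((2 * ((N + 1 : ℕ) : ℝ) + 1) * x) = 2 * ((N : ℝ) + 1) * x + x := by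
      push_cast; ring
    have h2 : ((2 * (N : ℝ) + 1) * x) = 2 * ((N : ℝ) + 1) * x - x := by ring
    rw [h1, h2, Real.cos_add, Real.cos_sub]
    ring

/-- The Riemann-Lebesgue lemma for the functions `cos ((2N+1)x)` on `(0, π/2]`. -/
theorem tendsto_integral_mul_cos_odd {g : ℝ → ℝ}
    (hg : MeasureTheory.IntegrableOn g (Set.Ioc 0 (Real.pi / 2))) :
    Filter.Tendsto (fun N : ℕ => ∫ x in (0 : ℝ)..(Real.pi / 2), g x * Real.cos ((2 * N + 1) * x))
      Filter.atTop (nhds 0) := by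
  have hpi := Real.pi_pos
  set G : ℝ → ℂ := (Set.Ioc 0 (Real.pi / 2)).indicator fun x => (g x : ℂ) with hG
  have hGi : MeasureTheory.Integrable G :=
    MeasureTheory.IntegrableOn.integrable_indicator hg.ofReal measurableSet_Ioc
  have hw : Filter.Tendsto (fun N : ℕ => (2 * (N : ℝ) + 1) / (2 * Real.pi)) Filter.atTop
      (Filter.cocompact ℝ) := by
    refine Filter.Tendsto.mono_right ?_ atTop_le_cocompact
    refine Filter.Tendsto.atTop_div_const (by positivity) ?_
    refine Filter.tendsto_atTop_add_const_right _ _ ?_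
    exact tendsto_natCast_atTop_atTop.const_mul_atTop (by norm_num)
  have h := (Real.tendsto_integral_exp_smul_cocompact G).comp hw
  have h' := (Complex.continuous_re.tendsto _).comp h
  rw [Complex.zero_re] at h'
  refine h'.congr fun N => ?_
  have hfund : MeasureTheory.Integrable fun v : ℝ =>
      Real.fourierChar (-(v * ((2 * (N : ℝ) + 1) / (2 * Real.pi)))) • G v := by
    have hc : Continuous fun v : ℝ =>
        (Real.fourierChar (-(v * ((2 * (N : ℝ) + 1) / (2 * Real.pi)))) : ℂ) :=
      continuous_subtype_val.comp (Real.continuous_fourierChar.comp (by fun_prop))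
    exact hGi.bdd_smul 1 hc.aestronglyMeasurable
      (Filter.Eventually.of_forall fun v => (Circle.norm_coe _).le)
  simp only [Function.comp]
  rw [← Complex.reCLM_apply, ← Complex.reCLM.integral_comp_comm hfund,
    intervalIntegral.integral_of_le (by positivity), ← MeasureTheory.integral_indicator
    measurableSet_Ioc]
  refine MeasureTheory.integral_congr_ae (Filter.Eventually.of_forall fun x => ?_)
  simp only [hG, Set.indicator]
  split_ifs
  · rw [Circle.smul_def, Real.fourierChar_apply, Complex.reCLM_apply, smul_eq_mul,
      Complex.re_mul_ofReal, Complex.exp_ofReal_mul_I_re, mul_comm]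
    congr 1
    rw [← Real.cos_neg]
    congr 1
    field_simp
  · simp

theorem tendsto_sum_integral_mul_sin {P : ℝ → ℝ} (hP : Continuous P) {C : ℝ}
    (hC : ∀ x ∈ Set.Ioc 0 (Real.pi / 2), |P x| ≤ C * x) :
    Filter.Tendsto (fun N : ℕ => ∑ n ∈ Finset.range N,
        2 * ∫ x in (0 : ℝ)..(Real.pi / 2), P x * Real.sin (2 * ((n : ℝ) + 1) * x))
      Filter.atTop (nhds (∫ x in (0 : ℝ)..(Real.pi / 2), P x * (Real.cos x / Real.sin x))) := by
  have hpi := Real.pi_pos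
  have hsin : ∀ x ∈ Set.Ioc 0 (Real.pi / 2), 0 < Real.sin x := fun x hx =>
    Real.sin_pos_of_pos_of_lt_pi hx.1 (by linarith [hx.2])
  have hbd : ∀ x ∈ Set.Ioc 0 (Real.pi / 2), ‖P x / Real.sin x‖ ≤ C * (Real.pi / 2) := by
    intro x hx
    have h1 := Real.mul_le_sin hx.1.le hx.2
    have h2 := hC x hx
    have h3 := hsin x hx
    have h4 : 0 ≤ C := by
      by_contra hneg
      nlinarith [abs_nonneg (P x), mul_pos (neg_pos.2 (not_le.1 hneg)) hx.1]
    rw [norm_div, Real.norm_eq_abs, Real.norm_eq_abs, abs_of_pos h3, div_le_iff₀ h3]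
    calc |P x| ≤ C * x := h2
      _ = C * (Real.pi / 2) * (2 / Real.pi * x) := by field_simp
      _ ≤ _ := by gcongr
  have hgi : MeasureTheory.IntegrableOn (fun x => P x / Real.sin x) (Set.Ioc 0 (Real.pi / 2)) := by
    refine MeasureTheory.Measure.integrableOn_of_bounded (M := C * (Real.pi / 2)) (by simp) ?_ ?_
    · exact (hP.measurable.div Real.measurable_sin).aestronglyMeasurable
    · exact (MeasureTheory.ae_restrict_iff' measurableSet_Ioc).2 (Filter.Eventually.of_forall hbd)
  have hgii := (intervalIntegrable_iff_integrableOn_Ioc_of_le (by positivity)).2 hgi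
  have hmul : ∀ h : ℝ → ℝ, Continuous h → IntervalIntegrable
      (fun x => P x / Real.sin x * h x) MeasureTheory.volume 0 (Real.pi / 2) := fun h hh =>
    hgii.mul_continuousOn hh.continuousOn
  have key : ∀ N : ℕ, ∑ n ∈ Finset.range N,
        2 * ∫ x in (0 : ℝ)..(Real.pi / 2), P x * Real.sin (2 * ((n : ℝ) + 1) * x) =
      (∫ x in (0 : ℝ)..(Real.pi / 2), P x * (Real.cos x / Real.sin x)) -
        ∫ x in (0 : ℝ)..(Real.pi / 2), P x / Real.sin x * Real.cos ((2 * N + 1) * x) := by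
    intro N
    have e : (∫ x in (0 : ℝ)..(Real.pi / 2), P x * (Real.cos x / Real.sin x)) =
        ∫ x in (0 : ℝ)..(Real.pi / 2), P x / Real.sin x * Real.cos x := by
      congr 1; ext x; ring
    rw [e, ← intervalIntegral.integral_sub (hmul _ Real.continuous_cos) (hmul _ (by fun_prop))]
    simp_rw [← intervalIntegral.integral_const_mul]
    rw [← intervalIntegral.integral_finsetSum
      fun n _ => Continuous.intervalIntegrable (by fun_prop) _ _]
    refine intervalIntegral.integral_congr_uIoo fun x hx => ?_
    rw [Set.uIoo_of_le (by positivity)] at hx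
    have h3 := (hsin x ⟨hx.1, hx.2.le⟩).ne'
    rw [← mul_sub, ← sum_two_mul_sin_mul_sin, Finset.sum_mul, Finset.mul_sum]
    refine Finset.sum_congr rfl fun n _ => ?_
    field_simp
  simp_rw [key]
  simpa using (tendsto_integral_mul_cos_odd hgi).const_sub
    (∫ x in (0 : ℝ)..(Real.pi / 2), P x * (Real.cos x / Real.sin x))

open scoped Polynomial

/-- The sine moment `2 ∫₀^{π/2} Q(2x) sin(2nx) dx` of a polynomial, with `n + 1` for `n`. -/
noncomputable def sinIntegral (Q : ℝ[X]) (n : ℕ) : ℝ :=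
  2 * ∫ x in (0 : ℝ)..(Real.pi / 2), Q.eval (2 * x) * Real.sin (2 * ((n : ℝ) + 1) * x)

theorem sinIntegral_eq (Q : ℝ[X]) (n : ℕ) :
    sinIntegral Q n = (Q.eval 0 - (-1) ^ (n + 1) * Q.eval Real.pi) / ((n : ℝ) + 1) -
      sinIntegral (Polynomial.derivative (Polynomial.derivative Q)) n / ((n : ℝ) + 1) ^ 2 := by
  have hn : (n : ℝ) + 1 ≠ 0 := by positivity
  have hd : ∀ (Q : ℝ[X]) (x : ℝ), HasDerivAt (fun x : ℝ => Q.eval (2 * x))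
      (2 * (Polynomial.derivative Q).eval (2 * x)) x := by
    intro Q x
    have h := (Q.hasDerivAt (2 * x)).comp x ((hasDerivAt_id x).const_mul 2)
    exact h.congr_deriv (by simp; ring)
  have hl : ∀ x : ℝ, HasDerivAt (fun x : ℝ => 2 * ((n : ℝ) + 1) * x) (2 * ((n : ℝ) + 1)) x :=
    fun x => ((hasDerivAt_id x).const_mul _).congr_deriv (by simp)
  have hG : ∀ x : ℝ, HasDerivAt (fun x : ℝ =>
        (Polynomial.derivative Q).eval (2 * x) * Real.sin (2 * ((n : ℝ) + 1) * x) /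
          ((n : ℝ) + 1) ^ 2 -
        Q.eval (2 * x) * Real.cos (2 * ((n : ℝ) + 1) * x) / ((n : ℝ) + 1))
      (2 * (Q.eval (2 * x) * Real.sin (2 * ((n : ℝ) + 1) * x)) +
        2 * ((Polynomial.derivative (Polynomial.derivative Q)).eval (2 * x) *
          Real.sin (2 * ((n : ℝ) + 1) * x)) / ((n : ℝ) + 1) ^ 2) x := by
    intro x
    refine ((((hd (Polynomial.derivative Q) x).mul (hl x).sin).div_const _).sub
      (((hd Q x).mul (hl x).cos).div_const _)).congr_deriv ?_
    field_simp
    ring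
  have hfund := intervalIntegral.integral_eq_sub_of_hasDerivAt (a := 0) (b := Real.pi / 2)
    (fun x _ => hG x) (Continuous.intervalIntegrable (by fun_prop) _ _)
  rw [intervalIntegral.integral_add (Continuous.intervalIntegrable (by fun_prop) _ _)
    (Continuous.intervalIntegrable (by fun_prop) _ _), intervalIntegral.integral_div,
    intervalIntegral.integral_const_mul, intervalIntegral.integral_const_mul] at hfund
  have e1 : 2 * ((n : ℝ) + 1) * (Real.pi / 2) = ((n + 1 : ℕ) : ℝ) * Real.pi := by
    push_cast; ring
  have e2 : 2 * (Real.pi / 2) = Real.pi := by ring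
  rw [e1, e2, Real.sin_nat_mul_pi, Real.cos_nat_mul_pi] at hfund
  simp only [mul_zero, Real.sin_zero, Real.cos_zero, mul_one, zero_div, zero_sub, sub_neg_eq_add]
    at hfund
  unfold sinIntegral
  linear_combination hfund

theorem sinIntegral_zero (n : ℕ) : sinIntegral 0 n = 0 := by simp [sinIntegral]

theorem sinIntegral_iterate {Q : ℝ[X]} (hQ : Q.natDegree ≤ 7) (n : ℕ) :
    sinIntegral Q n =
      (Q.eval 0 - (-1) ^ (n + 1) * Q.eval Real.pi) / ((n : ℝ) + 1) -
      ((Polynomial.derivative^[2] Q).eval 0 -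
        (-1) ^ (n + 1) * (Polynomial.derivative^[2] Q).eval Real.pi) / ((n : ℝ) + 1) ^ 3 +
      ((Polynomial.derivative^[4] Q).eval 0 -
        (-1) ^ (n + 1) * (Polynomial.derivative^[4] Q).eval Real.pi) / ((n : ℝ) + 1) ^ 5 -
      ((Polynomial.derivative^[6] Q).eval 0 -
        (-1) ^ (n + 1) * (Polynomial.derivative^[6] Q).eval Real.pi) / ((n : ℝ) + 1) ^ 7 := by
  have h8 : Polynomial.derivative^[8] Q = 0 :=
    Polynomial.iterate_derivative_eq_zero (by omega)
  have hn : (n : ℝ) + 1 ≠ 0 := by positivity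
  simp only [Function.iterate_succ, Function.iterate_zero, Function.comp, id] at h8 ⊢
  rw [sinIntegral_eq, sinIntegral_eq, sinIntegral_eq, sinIntegral_eq, h8, sinIntegral_zero]
  field_simp
  ring


theorem eval_iterate_derivative_C_mul_X_pow (k m : ℕ) (c x : ℝ) :
    (Polynomial.derivative^[k] (Polynomial.C c * Polynomial.X ^ m)).eval x =
      c * (m.descFactorial k * x ^ (m - k)) := by
  simp [Polynomial.iterate_derivative_C_mul, Polynomial.iterate_derivative_X_pow_eq_C_mul]

theorem sinIntegral_sub_pow_three_mul_pow_two (n : ℕ) :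
    sinIntegral ((Polynomial.C Real.pi - Polynomial.X) ^ 3 * Polynomial.X ^ 2) n =
      (-2 * Real.pi ^ 3 + 0 * (-1) ^ (n + 1)) / ((n : ℝ) + 1) ^ 3 +
      (72 * Real.pi ^ 1 + 48 * Real.pi ^ 1 * (-1) ^ (n + 1)) / ((n : ℝ) + 1) ^ 5 +
      (0 + 0 * (-1) ^ (n + 1)) / ((n : ℝ) + 1) ^ 7 := by
  have h : ((Polynomial.C Real.pi - Polynomial.X) ^ 3 * Polynomial.X ^ 2 : ℝ[X]) =
      Polynomial.C (1 * Real.pi ^ 3) * Polynomial.X ^ 2 +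
        Polynomial.C (-3 * Real.pi ^ 2) * Polynomial.X ^ 3 +
        Polynomial.C (3 * Real.pi ^ 1) * Polynomial.X ^ 4 +
        Polynomial.C (-1 * Real.pi ^ 0) * Polynomial.X ^ 5 := by
    simp only [map_pow, map_mul, map_neg, map_one, Polynomial.C_ofNat]
    ring
  have hd : ((Polynomial.C Real.pi - Polynomial.X) ^ 3 * Polynomial.X ^ 2 :
      ℝ[X]).natDegree ≤ 7 := by
    compute_degree!
  rw [sinIntegral_iterate hd, h]
  simp only [iterate_map_add, Polynomial.eval_add, eval_iterate_derivative_C_mul_X_pow]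
  simp [Nat.descFactorial]
  have hn : (n : ℝ) + 1 ≠ 0 := by positivity
  field_simp
  ring

theorem sinIntegral_sub_mul_pow_four (n : ℕ) :
    sinIntegral ((Polynomial.C Real.pi - Polynomial.X) ^ 1 * Polynomial.X ^ 4) n =
      (0 + -8 * Real.pi ^ 3 * (-1) ^ (n + 1)) / ((n : ℝ) + 1) ^ 3 +
      (24 * Real.pi ^ 1 + 96 * Real.pi ^ 1 * (-1) ^ (n + 1)) / ((n : ℝ) + 1) ^ 5 +
      (0 + 0 * (-1) ^ (n + 1)) / ((n : ℝ) + 1) ^ 7 := by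
  have h : ((Polynomial.C Real.pi - Polynomial.X) ^ 1 * Polynomial.X ^ 4 : ℝ[X]) =
      Polynomial.C (1 * Real.pi ^ 1) * Polynomial.X ^ 4 +
        Polynomial.C (-1 * Real.pi ^ 0) * Polynomial.X ^ 5 := by
    simp only [map_pow, map_mul, map_neg, map_one]
    ring
  have hd : ((Polynomial.C Real.pi - Polynomial.X) ^ 1 * Polynomial.X ^ 4 :
      ℝ[X]).natDegree ≤ 7 := by
    compute_degree!
  rw [sinIntegral_iterate hd, h]
  simp only [iterate_map_add, Polynomial.eval_add, eval_iterate_derivative_C_mul_X_pow]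
  simp [Nat.descFactorial]
  have hn : (n : ℝ) + 1 ≠ 0 := by positivity
  field_simp
  ring

theorem sinIntegral_sub_pow_five_mul_pow_two (n : ℕ) :
    sinIntegral ((Polynomial.C Real.pi - Polynomial.X) ^ 5 * Polynomial.X ^ 2) n =
      (-2 * Real.pi ^ 5 + 0 * (-1) ^ (n + 1)) / ((n : ℝ) + 1) ^ 3 +
      (240 * Real.pi ^ 3 + 0 * (-1) ^ (n + 1)) / ((n : ℝ) + 1) ^ 5 +
      (-3600 * Real.pi ^ 1 + -1440 * Real.pi ^ 1 * (-1) ^ (n + 1)) / ((n : ℝ) + 1) ^ 7 := by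
  have h : ((Polynomial.C Real.pi - Polynomial.X) ^ 5 * Polynomial.X ^ 2 : ℝ[X]) =
      Polynomial.C (1 * Real.pi ^ 5) * Polynomial.X ^ 2 +
        Polynomial.C (-5 * Real.pi ^ 4) * Polynomial.X ^ 3 +
        Polynomial.C (10 * Real.pi ^ 3) * Polynomial.X ^ 4 +
        Polynomial.C (-10 * Real.pi ^ 2) * Polynomial.X ^ 5 +
        Polynomial.C (5 * Real.pi ^ 1) * Polynomial.X ^ 6 +
        Polynomial.C (-1 * Real.pi ^ 0) * Polynomial.X ^ 7 := by
    simp only [map_pow, map_mul, map_neg, map_one, Polynomial.C_ofNat]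
    ring
  have hd : ((Polynomial.C Real.pi - Polynomial.X) ^ 5 * Polynomial.X ^ 2 :
      ℝ[X]).natDegree ≤ 7 := by
    compute_degree!
  rw [sinIntegral_iterate hd, h]
  simp only [iterate_map_add, Polynomial.eval_add, eval_iterate_derivative_C_mul_X_pow]
  simp [Nat.descFactorial]
  have hn : (n : ℝ) + 1 ≠ 0 := by positivity
  field_simp
  ring

theorem sinIntegral_sub_pow_three_mul_pow_four (n : ℕ) :
    sinIntegral ((Polynomial.C Real.pi - Polynomial.X) ^ 3 * Polynomial.X ^ 4) n =
      (0 + 0 * (-1) ^ (n + 1)) / ((n : ℝ) + 1) ^ 3 +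
      (24 * Real.pi ^ 3 + 96 * Real.pi ^ 3 * (-1) ^ (n + 1)) / ((n : ℝ) + 1) ^ 5 +
      (-2160 * Real.pi ^ 1 + -2880 * Real.pi ^ 1 * (-1) ^ (n + 1)) / ((n : ℝ) + 1) ^ 7 := by
  have h : ((Polynomial.C Real.pi - Polynomial.X) ^ 3 * Polynomial.X ^ 4 : ℝ[X]) =
      Polynomial.C (1 * Real.pi ^ 3) * Polynomial.X ^ 4 +
        Polynomial.C (-3 * Real.pi ^ 2) * Polynomial.X ^ 5 +
        Polynomial.C (3 * Real.pi ^ 1) * Polynomial.X ^ 6 +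
        Polynomial.C (-1 * Real.pi ^ 0) * Polynomial.X ^ 7 := by
    simp only [map_pow, map_mul, map_neg, map_one, Polynomial.C_ofNat]
    ring
  have hd : ((Polynomial.C Real.pi - Polynomial.X) ^ 3 * Polynomial.X ^ 4 :
      ℝ[X]).natDegree ≤ 7 := by
    compute_degree!
  rw [sinIntegral_iterate hd, h]
  simp only [iterate_map_add, Polynomial.eval_add, eval_iterate_derivative_C_mul_X_pow]
  simp [Nat.descFactorial]
  have hn : (n : ℝ) + 1 ≠ 0 := by positivity
  field_simp
  ring

theorem sinIntegral_sub_mul_pow_six (n : ℕ) :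
    sinIntegral ((Polynomial.C Real.pi - Polynomial.X) ^ 1 * Polynomial.X ^ 6) n =
      (0 + -12 * Real.pi ^ 5 * (-1) ^ (n + 1)) / ((n : ℝ) + 1) ^ 3 +
      (0 + 480 * Real.pi ^ 3 * (-1) ^ (n + 1)) / ((n : ℝ) + 1) ^ 5 +
      (-720 * Real.pi ^ 1 + -4320 * Real.pi ^ 1 * (-1) ^ (n + 1)) / ((n : ℝ) + 1) ^ 7 := by
  have h : ((Polynomial.C Real.pi - Polynomial.X) ^ 1 * Polynomial.X ^ 6 : ℝ[X]) =
      Polynomial.C (1 * Real.pi ^ 1) * Polynomial.X ^ 6 +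
        Polynomial.C (-1 * Real.pi ^ 0) * Polynomial.X ^ 7 := by
    simp only [map_pow, map_mul, map_neg, map_one]
    ring
  have hd : ((Polynomial.C Real.pi - Polynomial.X) ^ 1 * Polynomial.X ^ 6 :
      ℝ[X]).natDegree ≤ 7 := by
    compute_degree!
  rw [sinIntegral_iterate hd, h]
  simp only [iterate_map_add, Polynomial.eval_add, eval_iterate_derivative_C_mul_X_pow]
  simp [Nat.descFactorial]
  have hn : (n : ℝ) + 1 ≠ 0 := by positivity
  field_simp
  ring

theorem HasSum.congr_terms {f g : ℕ → ℝ} {s : ℝ} (hf : HasSum f s) (h : ∀ n, g n = f n) :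
    HasSum g s := by
  rwa [funext h]

theorem hasSum_neg_one_pow_div_succ_pow {k : ℕ} (hk : 2 ≤ k) :
    HasSum (fun n : ℕ => (-1 : ℝ) ^ (n + 1) / ((n : ℝ) + 1) ^ k)
      (-(1 - 2 / 2 ^ k) * ∑' n : ℕ, 1 / ((n : ℝ) + 1) ^ k) := by
  have hs := summable_one_div_succ_pow hk
  set Z := ∑' n : ℕ, 1 / ((n : ℝ) + 1) ^ k with hZ
  have hodd : HasSum (fun n : ℕ => 1 / (((2 * n + 1 : ℕ) : ℝ) + 1) ^ k) (1 / 2 ^ k * Z) := by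
    refine (hs.hasSum.mul_left (1 / 2 ^ k)).congr_terms fun n => ?_
    push_cast
    rw [show (2 * (n : ℝ) + 1 + 1) = 2 * (n + 1) by ring, mul_pow]
    field_simp
  have heven : HasSum (fun n : ℕ => 1 / (((2 * n : ℕ) : ℝ) + 1) ^ k) (Z - 1 / 2 ^ k * Z) := by
    have h1 : Summable fun n : ℕ => 1 / (((2 * n : ℕ) : ℝ) + 1) ^ k :=
      hs.comp_injective (mul_right_injective₀ (two_ne_zero (α := ℕ)))
    have h2 := (HasSum.even_add_odd (f := fun n : ℕ => 1 / ((n : ℝ) + 1) ^ k) h1.hasSum hodd).unique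
      hs.hasSum
    rw [show Z - 1 / 2 ^ k * Z = ∑' n : ℕ, 1 / (((2 * n : ℕ) : ℝ) + 1) ^ k by
      rw [hZ]; linarith]
    exact h1.hasSum
  have he : HasSum (fun n : ℕ => (-1 : ℝ) ^ (2 * n + 1) / (((2 * n : ℕ) : ℝ) + 1) ^ k)
      (-(Z - 1 / 2 ^ k * Z)) := by
    refine heven.neg.congr_terms fun n => ?_
    rw [pow_succ, pow_mul]
    simp
    ring
  have ho : HasSum (fun n : ℕ => (-1 : ℝ) ^ (2 * n + 1 + 1) / (((2 * n + 1 : ℕ) : ℝ) + 1) ^ k)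
      (1 / 2 ^ k * Z) := by
    refine hodd.congr_terms fun n => ?_
    rw [show 2 * n + 1 + 1 = 2 * (n + 1) by ring, pow_mul]
    simp
  have h3 := HasSum.even_add_odd (f := fun n : ℕ => (-1 : ℝ) ^ (n + 1) / ((n : ℝ) + 1) ^ k) he ho
  convert h3 using 1
  ring

theorem hasSum_sinMomentRatio_mul_zetaTwos_of_sinIntegral {a b : ℕ} {Z : ℕ → ℝ}
    (hZ : ∀ k, Z k = ∑' n : ℕ, 1 / ((n : ℝ) + 1) ^ k) {α₃ β₃ α₅ β₅ α₇ β₇ : ℝ}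
    (h : ∀ n, sinIntegral ((Polynomial.C Real.pi - Polynomial.X) ^ (2 * a + 1) *
        Polynomial.X ^ (2 * b + 2)) n =
      (α₃ + β₃ * (-1) ^ (n + 1)) / ((n : ℝ) + 1) ^ 3 +
      (α₅ + β₅ * (-1) ^ (n + 1)) / ((n : ℝ) + 1) ^ 5 +
      (α₇ + β₇ * (-1) ^ (n + 1)) / ((n : ℝ) + 1) ^ 7) :
    HasSum (fun n => sinMomentRatio a (n + 1) * (zetaTwos b n / ((n : ℝ) + 1) ^ 3))
      (2 / Real.pi / ((2 * a + 1).factorial * (2 * b + 2).factorial) *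
        ((α₃ - 3 / 4 * β₃) * Z 3 + (α₅ - 15 / 16 * β₅) * Z 5 + (α₇ - 63 / 64 * β₇) * Z 7)) := by
  have hpi := Real.pi_pos
  set P : ℝ → ℝ := fun x => (Real.pi - 2 * x) ^ (2 * a + 1) * (2 * x) ^ (2 * b + 2) with hPdef
  have hfund : ∀ n : ℕ, 2 * ∫ x in (0 : ℝ)..(Real.pi / 2), P x * Real.sin (2 * ((n : ℝ) + 1) * x) =
      sinIntegral ((Polynomial.C Real.pi - Polynomial.X) ^ (2 * a + 1) *
        Polynomial.X ^ (2 * b + 2)) n := by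
    intro n
    simp [sinIntegral, hPdef]
  have hC : ∀ x ∈ Set.Ioc 0 (Real.pi / 2),
      |P x| ≤ 2 * (Real.pi ^ (2 * a + 1) * Real.pi ^ (2 * b + 1)) * x := by
    intro x hx
    have h0 := hx.1
    have h1 : 0 ≤ Real.pi - 2 * x := by linarith [hx.2]
    have h2 : Real.pi - 2 * x ≤ Real.pi := by linarith
    have h3 : 2 * x ≤ Real.pi := by linarith [hx.2]
    rw [abs_of_nonneg (by positivity), hPdef]
    calc (Real.pi - 2 * x) ^ (2 * a + 1) * (2 * x) ^ (2 * b + 2)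
        = (Real.pi - 2 * x) ^ (2 * a + 1) * (2 * x) ^ (2 * b + 1) * (2 * x) := by ring
      _ ≤ Real.pi ^ (2 * a + 1) * Real.pi ^ (2 * b + 1) * (2 * x) := by gcongr
      _ = _ := by ring
  have hlim := tendsto_sum_integral_mul_sin (P := P) (by fun_prop) hC
  simp_rw [hfund, h] at hlim
  have hsum : ∀ k, 2 ≤ k → ∀ α β : ℝ, HasSum
      (fun n : ℕ => (α + β * (-1) ^ (n + 1)) / ((n : ℝ) + 1) ^ k)
      ((α - (1 - 2 / 2 ^ k) * β) * Z k) := by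
    intro k hk α β
    have hs := summable_one_div_succ_pow hk
    have h1 := (hs.hasSum.mul_left α).add ((hasSum_neg_one_pow_div_succ_pow hk).mul_left β)
    rw [← hZ, show α * Z k + β * (-(1 - 2 / 2 ^ k) * Z k) = (α - (1 - 2 / 2 ^ k) * β) * Z k by
      ring] at h1
    refine h1.congr_terms fun n => ?_
    ring
  have hval := tendsto_nhds_unique hlim
    (((hsum 3 (by norm_num) α₃ β₃).add (hsum 5 (by norm_num) α₅ β₅)).add
      (hsum 7 (by norm_num) α₇ β₇)).tendsto_sum_nat
  have hmain := hasSum_sinMomentRatio_mul_zetaTwos a b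
  have hcot : ∫ x in (0 : ℝ)..(Real.pi / 2), cotKernel a x *
      ((2 * x) ^ (2 * b + 2) / (2 * b + 2).factorial) =
      1 / ((2 * a + 1).factorial * (2 * b + 2).factorial) *
        ∫ x in (0 : ℝ)..(Real.pi / 2), P x * (Real.cos x / Real.sin x) := by
    rw [← intervalIntegral.integral_const_mul]
    congr 1
    ext x
    simp only [cotKernel, hPdef]
    ring
  rw [hcot, hval] at hmain
  convert hmain using 1
  norm_num
  ring

theorem tsum_sinMomentRatio_mul_mzvTrunc_cons (k s : ℕ) (t : List ℕ) :
    ∑' m : ℕ, ENNReal.ofReal (sinMomentRatio k (m + 1) *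
        (mzvTrunc (s :: t) m / ((m : ℝ) + 1) ^ 2)) =
      ∑' n : ℕ, ENNReal.ofReal (sinMomentRatio (k + 1) (n + 1) *
        (mzvTrunc t n / ((n : ℝ) + 1) ^ s)) := by
  refine tsum_weight_mul_mzvTrunc_cons (fun m => sinMomentRatio k (m + 1))
    (fun n => sinMomentRatio (k + 1) (n + 1)) (fun n => sinMomentRatio_nonneg _ _) (fun n => ?_) s t
  have h := hasSum_sinMomentRatio k (n + 1)
  convert h using 3 with j
  congr 1
  ring

theorem mzv_replicate_two_append_three (a b : ℕ) :
    mzv (List.replicate a 2 ++ 3 :: List.replicate b 2) =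
      ∑' n : ℕ, sinMomentRatio a (n + 1) * (zetaTwos b n / ((n : ℝ) + 1) ^ 3) := by
  have key : ∀ a k s t, List.replicate a 2 ++ 3 :: List.replicate b 2 = s :: t →
      ∑' m : ℕ, ENNReal.ofReal (sinMomentRatio k (m + 1) * (mzvTrunc t m / ((m : ℝ) + 1) ^ s)) =
      ∑' n : ℕ, ENNReal.ofReal (sinMomentRatio (k + a) (n + 1) *
        (zetaTwos b n / ((n : ℝ) + 1) ^ 3)) := by
    intro a
    induction a with
    | zero =>
      intro k s t h
      simp only [List.replicate_zero, List.nil_append, List.cons.injEq] at h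
      obtain ⟨rfl, rfl⟩ := h
      rfl
    | succ a ih =>
      intro k s t h
      rw [List.replicate_succ, List.cons_append, List.cons.injEq] at h
      obtain ⟨rfl, rfl⟩ := h
      obtain ⟨s', t', ht⟩ : ∃ s' t', List.replicate a 2 ++ 3 :: List.replicate b 2 = s' :: t' :=
        List.exists_cons_of_ne_nil (by simp)
      rw [ht, tsum_sinMomentRatio_mul_mzvTrunc_cons, ih (k + 1) s' t' ht, add_right_comm]
      rfl
  obtain ⟨s, t, ht⟩ : ∃ s t, List.replicate a 2 ++ 3 :: List.replicate b 2 = s :: t :=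
    List.exists_cons_of_ne_nil (by simp)
  have h := key a 0 s t ht
  simp only [sinMomentRatio_zero, one_mul, zero_add] at h
  have hnn : ∀ n : ℕ, 0 ≤ sinMomentRatio a (n + 1) * (zetaTwos b n / ((n : ℝ) + 1) ^ 3) := by
    intro n
    have h1 := sinMomentRatio_nonneg a (n + 1)
    have h2 : 0 ≤ zetaTwos b n := mzvTrunc_nonneg _ _
    positivity
  rw [ht, mzv_cons, h, ← ENNReal.ofReal_tsum_of_nonneg hnn
    (hasSum_sinMomentRatio_mul_zetaTwos a b).summable, ENNReal.toReal_ofReal (tsum_nonneg hnn)]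

theorem mzv_replicate_two_append_three_of_sinIntegral {a b : ℕ} {Z : ℕ → ℝ}
    (hZ : ∀ k, Z k = ∑' n : ℕ, 1 / ((n : ℝ) + 1) ^ k) {α₃ β₃ α₅ β₅ α₇ β₇ : ℝ}
    (h : ∀ n, sinIntegral ((Polynomial.C Real.pi - Polynomial.X) ^ (2 * a + 1) *
        Polynomial.X ^ (2 * b + 2)) n =
      (α₃ + β₃ * (-1) ^ (n + 1)) / ((n : ℝ) + 1) ^ 3 +
      (α₅ + β₅ * (-1) ^ (n + 1)) / ((n : ℝ) + 1) ^ 5 +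
      (α₇ + β₇ * (-1) ^ (n + 1)) / ((n : ℝ) + 1) ^ 7) :
    mzv (List.replicate a 2 ++ 3 :: List.replicate b 2) =
      2 / Real.pi / ((2 * a + 1).factorial * (2 * b + 2).factorial) *
        ((α₃ - 3 / 4 * β₃) * Z 3 + (α₅ - 15 / 16 * β₅) * Z 5 + (α₇ - 63 / 64 * β₇) * Z 7) := by
  rw [mzv_replicate_two_append_three]
  exact (hasSum_sinMomentRatio_mul_zetaTwos_of_sinIntegral hZ h).tsum_eq

theorem mzv_three : mzv [3] = ∑' n : ℕ, 1 / ((n : ℝ) + 1) ^ 3 := by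
  have h := mzv_replicate_two_append_three 0 0
  simp only [sinMomentRatio_zero, zetaTwos_zero, one_mul] at h
  exact h

theorem mzv_two_three {Z : ℕ → ℝ}
    (hZ : ∀ k, Z k = ∑' n : ℕ, 1 / ((n : ℝ) + 1) ^ k) :
    mzv [2, 3] = -1 / 3 * (Real.pi ^ 2 * Z 3) + 9 / 2 * Z 5 := by
  have h := mzv_replicate_two_append_three_of_sinIntegral (a := 1) (b := 0) hZ
    sinIntegral_sub_pow_three_mul_pow_two
  have hpi := Real.pi_ne_zero
  refine h.trans ?_
  norm_num [Nat.factorial]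
  field_simp
  ring

theorem mzv_three_two {Z : ℕ → ℝ}
    (hZ : ∀ k, Z k = ∑' n : ℕ, 1 / ((n : ℝ) + 1) ^ k) :
    mzv [3, 2] = 1 / 2 * (Real.pi ^ 2 * Z 3) - 11 / 2 * Z 5 := by
  have h := mzv_replicate_two_append_three_of_sinIntegral (a := 0) (b := 1) hZ
    sinIntegral_sub_mul_pow_four
  have hpi := Real.pi_ne_zero
  refine h.trans ?_
  norm_num [Nat.factorial]
  field_simp
  ring

theorem mzv_two_two_three {Z : ℕ → ℝ}
    (hZ : ∀ k, Z k = ∑' n : ℕ, 1 / ((n : ℝ) + 1) ^ k) :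
    mzv [2, 2, 3] = -1 / 60 * (Real.pi ^ 4 * Z 3) + 2 * (Real.pi ^ 2 * Z 5) - 291 / 16 * Z 7 := by
  have h := mzv_replicate_two_append_three_of_sinIntegral (a := 2) (b := 0) hZ
    sinIntegral_sub_pow_five_mul_pow_two
  have hpi := Real.pi_ne_zero
  refine h.trans ?_
  norm_num [Nat.factorial]
  field_simp
  ring

theorem mzv_two_three_two {Z : ℕ → ℝ}
    (hZ : ∀ k, Z k = ∑' n : ℕ, 1 / ((n : ℝ) + 1) ^ k) :
    mzv [2, 3, 2] = -11 / 12 * (Real.pi ^ 2 * Z 5) + 75 / 8 * Z 7 := by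
  have h := mzv_replicate_two_append_three_of_sinIntegral (a := 1) (b := 1) hZ
    sinIntegral_sub_pow_three_mul_pow_four
  have hpi := Real.pi_ne_zero
  refine h.trans ?_
  norm_num [Nat.factorial]
  field_simp
  ring

theorem mzv_three_two_two {Z : ℕ → ℝ}
    (hZ : ∀ k, Z k = ∑' n : ℕ, 1 / ((n : ℝ) + 1) ^ k) :
    mzv [3, 2, 2] =
      1 / 40 * (Real.pi ^ 4 * Z 3) - 5 / 4 * (Real.pi ^ 2 * Z 5) + 157 / 16 * Z 7 := by
  have h := mzv_replicate_two_append_three_of_sinIntegral (a := 0) (b := 2) hZ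
    sinIntegral_sub_mul_pow_six
  have hpi := Real.pi_ne_zero
  refine h.trans ?_
  norm_num [Nat.factorial]
  field_simp
  ring

theorem exists_eq_add_mul_of_not_linearIndependent {z v : ℝ} (hz : ∀ q : ℚ, z ≠ q)
    (h : ¬ LinearIndependent ℚ ![(1 : ℝ), z, v]) : ∃ a b : ℚ, v = a + b * z := by
  rw [Fintype.not_linearIndependent_iff] at h
  obtain ⟨g, hg, i, hi⟩ := h
  simp only [Fin.sum_univ_three, Matrix.cons_val, Rat.smul_def, mul_one] at hg
  by_cases h2 : g 2 = 0
  · by_cases h1 : g 1 = 0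
    · have h0 : g 0 = 0 := by simpa [h1, h2] using hg
      fin_cases i <;> contradiction
    · refine absurd ?_ (hz (-g 0 / g 1))
      have h1' : (g 1 : ℝ) ≠ 0 := by exact_mod_cast h1
      push_cast
      rw [eq_div_iff h1']
      simp only [h2, Rat.cast_zero, zero_mul, add_zero] at hg
      linarith
  · have h2' : (g 2 : ℝ) ≠ 0 := by exact_mod_cast h2
    refine ⟨-g 0 / g 2, -g 1 / g 2, ?_⟩
    push_cast
    field_simp
    linarith

theorem false_of_pi_sq_mul_eq {z : ℝ} {a b c d : ℚ} (h₁ : Real.pi ^ 2 * z = a + b * z)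
    (h₂ : Real.pi ^ 4 * z = c + d * z) (hz : z ≠ 0) : False := by
  have h₃ : (a : ℝ) * Real.pi ^ 2 = c - b * a + (d - b ^ 2) * z := by
    linear_combination h₂ - (Real.pi ^ 2 + b) * h₁
  by_cases ha : a = 0
  · refine pi_sq_ne_ratCast b (mul_right_cancel₀ hz ?_)
    rw [h₁, ha]
    simp
  have ha' : (a : ℝ) ≠ 0 := by exact_mod_cast ha
  by_cases hd : d - b ^ 2 = 0
  · have hd' : (d : ℝ) - b ^ 2 = 0 := by exact_mod_cast hd
    refine pi_sq_ne_ratCast ((c - b * a) / a) ?_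
    push_cast
    rw [eq_div_iff ha']
    linear_combination h₃ + z * hd'
  · have h := pi_sq_quadratic_ne_zero (-(c - b * a) / a - b)
      (((c - b * a) * b - a * (d - b ^ 2)) / a)
    refine h ?_
    push_cast
    field_simp
    linear_combination (Real.pi ^ 2 - b) * h₃ + (d - b ^ 2) * h₁

/-- There is `s₀` among the five vectors `(2,3), (3,2), (2,2,3), (2,3,2), (3,2,2)` with
`1`, `ζ(3)`, `ζ(s₀)` linearly independent over `ℚ`. -/
theorem stmt_3 :
    ∃ s₀ ∈ ({[2, 3], [3, 2], [2, 2, 3], [2, 3, 2], [3, 2, 2]} : Set (List ℕ)),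
      LinearIndependent ℚ ![(1 : ℝ), mzv [3], mzv s₀] := by
  by_contra! hcon
  obtain ⟨Z, hZ⟩ : ∃ Z : ℕ → ℝ, ∀ k, Z k = ∑' n : ℕ, 1 / ((n : ℝ) + 1) ^ k := ⟨_, fun _ => rfl⟩
  have hirr : ∀ q : ℚ, mzv [3] ≠ q := fun q => mzv_three ▸ tsum_one_div_cube_ne_ratCast q
  have hz : mzv [3] = Z 3 := by rw [mzv_three, hZ]
  have hV := fun s hs => exists_eq_add_mul_of_not_linearIndependent hirr (hcon s hs)
  obtain ⟨a₁, b₁, h₁⟩ := hV [2, 3] (by simp)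
  obtain ⟨a₂, b₂, h₂⟩ := hV [3, 2] (by simp)
  obtain ⟨a₃, b₃, h₃⟩ := hV [2, 2, 3] (by simp)
  obtain ⟨a₄, b₄, h₄⟩ := hV [2, 3, 2] (by simp)
  obtain ⟨a₅, b₅, h₅⟩ := hV [3, 2, 2] (by simp)
  rw [hz] at hirr h₁ h₂ h₃ h₄ h₅
  rw [mzv_two_three hZ] at h₁
  rw [mzv_three_two hZ] at h₂
  rw [mzv_two_two_three hZ] at h₃
  rw [mzv_two_three_two hZ] at h₄
  rw [mzv_three_two_two hZ] at h₅
  refine false_of_pi_sq_mul_eq (z := Z 3)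
    (a := 66 / 5 * a₁ + 54 / 5 * a₂) (b := 66 / 5 * b₁ + 54 / 5 * b₂)
    (c := 62760/151 * a₃ + 71640/151 * a₄ + 47880/151 * a₅)
    (d := 62760/151 * b₃ + 71640/151 * b₄ + 47880/151 * b₅) ?_ ?_ ?_
  · push_cast
    linear_combination 66 / 5 * h₁ + 54 / 5 * h₂
  · push_cast
    linear_combination 62760/151 * h₃ + 71640/151 * h₄ + 47880/151 * h₅
  · simpa using hirr 0
end

section
/- For every positive integer k, the multiple zeta value with k repeated arguments equal to 2 satisfies ζ(2, 2, …, 2) = π^{2k}/(2k+1)!. -/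
open scoped BigOperators

/-- The family `∏ i ∈ s, y * f i`, summed by the cardinality of `s`, is a power series in `y`
whose sum is the infinite product `∏' i, (1 + y * f i)`. -/
theorem hasSum_pow_mul_tsum_card_eq {ι R : Type*} [NormedCommRing R] [NormOneClass R]
    [CompleteSpace R] {f : ι → R} (hf : Summable fun i ↦ ‖f i‖) (y : R) :
    HasSum (fun n : ℕ ↦ y ^ n * ∑' s : (Finset.card ⁻¹' {n} : Set (Finset ι)), ∏ i ∈ s.1, f i)
      (∏' i, (1 + y * f i)) := by
  have hy : Summable fun i ↦ ‖y * f i‖ :=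
    (hf.mul_left ‖y‖).of_nonneg_of_le (fun _ ↦ norm_nonneg _) fun _ ↦ norm_mul_le _ _
  have hs := summable_finsetProd_of_summable_norm hy
  have h := hs.hasSum.tsum_fiberwise Finset.card
  rw [← tprod_one_add hs] at h
  refine h.congr_fun fun n ↦ ?_
  refine (((summable_finsetProd_of_summable_norm hf).subtype _).tsum_mul_left _).symm.trans ?_
  refine tsum_congr fun s ↦ ?_
  have hn : s.1.card = n := s.2
  simp [Finset.prod_mul_distrib, hn]

theorem summable_norm_one_div_nat_add_one_sq :
    Summable fun i : ℕ ↦ ‖(1 : ℂ) / ((i : ℂ) + 1) ^ 2‖ := by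
  have h := (summable_nat_add_iff 1).mpr
    (Real.summable_one_div_nat_pow.mpr (by norm_num : 1 < 2))
  refine h.congr fun i ↦ ?_
  rw [norm_div, norm_pow, norm_one]
  norm_cast

/-- The Taylor series in `y` of the product `∏ (1 + y / n²) = sinh (π √y) / (π √y)`. -/
theorem hasSum_tprod_one_add_mul_one_div_sq (y : ℂ) :
    HasSum (fun n : ℕ ↦ y ^ n * ((Real.pi : ℂ) ^ (2 * n) / (Nat.factorial (2 * n + 1) : ℂ)))
      (∏' i : ℕ, (1 + y * (1 / ((i : ℂ) + 1) ^ 2))) := by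
  rcases eq_or_ne y 0 with rfl | hy
  · convert! hasSum_ite_eq 0 (1 : ℂ) using 2 with n
    · rcases n with _ | n <;> simp
    · simp
  obtain ⟨z, hz⟩ := IsAlgClosed.exists_pow_nat_eq (-y) (n := 2) (by norm_num)
  obtain rfl : y = -z ^ 2 := by rw [hz, neg_neg]
  have hz0 : z ≠ 0 := by rintro rfl; simp at hy
  have hpz : (Real.pi : ℂ) * z ≠ 0 := mul_ne_zero (by exact_mod_cast Real.pi_ne_zero) hz0
  have hm : Multipliable fun i : ℕ ↦ 1 + -z ^ 2 * (1 / ((i : ℂ) + 1) ^ 2) := by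
    refine multipliable_one_add_of_summable ?_
    simp_rw [norm_mul]
    exact summable_norm_one_div_nat_add_one_sq.mul_left _
  have hsin : (Real.pi : ℂ) * z * ∏' i : ℕ, (1 + -z ^ 2 * (1 / ((i : ℂ) + 1) ^ 2))
      = Complex.sin (Real.pi * z) := by
    refine tendsto_nhds_unique (hm.hasProd.tendsto_prod_nat.const_mul _)
      ((Complex.tendsto_euler_sin_prod z).congr fun n ↦ ?_)
    congr 1
    exact Finset.prod_congr rfl fun i _ ↦ by ring
  rw [← hasSum_mul_left_iff hpz, hsin]
  refine (Complex.hasSum_sin _).congr_fun fun n ↦ ?_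
  rw [neg_pow (z ^ 2)]
  ring

theorem tsum_card_eq_prod_one_div_sq (k : ℕ) :
    ∑' s : (Finset.card ⁻¹' {k} : Set (Finset ℕ)), ∏ i ∈ s.1, (1 : ℂ) / ((i : ℂ) + 1) ^ 2
      = (Real.pi : ℂ) ^ (2 * k) / (Nat.factorial (2 * k + 1) : ℂ) := by
  have key (c : ℕ → ℂ) (h : ∀ y : ℂ, HasSum (fun n ↦ y ^ n * c n)
      (∏' i : ℕ, (1 + y * (1 / ((i : ℂ) + 1) ^ 2)))) :
      HasFPowerSeriesAt (fun y : ℂ ↦ ∏' i : ℕ, (1 + y * (1 / ((i : ℂ) + 1) ^ 2)))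
        (.ofScalars ℂ c) 0 := by
    rw [hasFPowerSeriesAt_iff]
    refine .of_forall fun y ↦ ?_
    simpa [FormalMultilinearSeries.coeff_ofScalars] using h y
  have h := (key _ (hasSum_pow_mul_tsum_card_eq summable_norm_one_div_nat_add_one_sq)
    ).eq_formalMultilinearSeries (key _ hasSum_tprod_one_add_mul_one_div_sq)
  simpa only [FormalMultilinearSeries.coeff_ofScalars] using congr_arg (·.coeff k) h

/-- Finite sets of `k` naturals correspond to strictly decreasing `k`-tuples of positive integers,
by shifting the elements by one. -/
noncomputable def finsetEquivStrictAnti (k : ℕ) :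
    (Finset.card ⁻¹' {k} : Set (Finset ℕ)) ≃
      {n : Fin k → ℕ // StrictAnti n ∧ ∀ i, 0 < n i} :=
  Equiv.ofBijective
    (fun s ↦ ⟨fun i ↦ s.1.orderEmbOfFin s.2 i.rev + 1,
      fun i j hij ↦ by simpa using hij, fun i ↦ Nat.succ_pos _⟩) <| by
    constructor
    · rintro ⟨s, hs⟩ ⟨t, ht⟩ h
      have hst : ⇑(s.orderEmbOfFin hs) = t.orderEmbOfFin ht := by
        funext i
        simpa using congr_fun (congr_arg Subtype.val h) i.rev
      refine Subtype.ext (Finset.coe_injective ?_)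
      change (s : Set ℕ) = t
      rw [← Finset.range_orderEmbOfFin s hs, ← Finset.range_orderEmbOfFin t ht, hst]
    · rintro ⟨n, hn, hpos⟩
      have hmono : StrictMono fun i : Fin k ↦ n i.rev - 1 := fun i j hij ↦ by
        have := hn (Fin.rev_lt_rev.mpr hij)
        have := hpos i.rev
        dsimp only
        omega
      have hcard : (Finset.univ.image fun i : Fin k ↦ n i.rev - 1).card = k := by
        rw [Finset.card_image_of_injective _ hmono.injective, Finset.card_fin]
      refine ⟨⟨_, hcard⟩, Subtype.ext (funext fun i ↦ ?_)⟩
      have := congr_fun (Finset.orderEmbOfFin_unique hcard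
        (fun i ↦ Finset.mem_image_of_mem _ (Finset.mem_univ i)) hmono) i.rev
      dsimp only at this ⊢
      rw [← this, Fin.rev_rev, Nat.sub_add_cancel (hpos i)]

theorem prod_finsetEquivStrictAnti {M : Type*} [CommMonoid M] {k : ℕ} (f : ℕ → M)
    (s : (Finset.card ⁻¹' {k} : Set (Finset ℕ))) :
    ∏ i, f ((finsetEquivStrictAnti k s).1 i) = ∏ i ∈ s.1, f (i + 1) := by
  change ∏ i : Fin k, f (s.1.orderEmbOfFin s.2 i.rev + 1) = _
  refine (Equiv.prod_comp Fin.revPerm fun i ↦ f (s.1.orderEmbOfFin s.2 i + 1)).trans ?_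
  conv_rhs => rw [← Finset.image_orderEmbOfFin_univ s.1 s.2]
  rw [Finset.prod_image fun _ _ _ _ h ↦ (s.1.orderEmbOfFin s.2).injective h]

theorem mzv_replicate_two (k : ℕ) :
    mzv (List.replicate k 2) =
      ∑' s : (Finset.card ⁻¹' {k} : Set (Finset ℕ)), ∏ i ∈ s.1, (1 : ℝ) / ((i : ℝ) + 1) ^ 2 := by
  have h (l : List ℕ) (hl : ∀ a ∈ l, a = 2) : mzv l =
      ∑' s : (Finset.card ⁻¹' {l.length} : Set (Finset ℕ)),
        ∏ i ∈ s.1, (1 : ℝ) / ((i : ℝ) + 1) ^ 2 := by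
    rw [mzv, ← (finsetEquivStrictAnti l.length).tsum_eq]
    refine tsum_congr fun s ↦ ?_
    simp_rw [hl _ (l.get_mem _)]
    rw [prod_finsetEquivStrictAnti fun n ↦ (1 : ℝ) / (n : ℝ) ^ 2]
    simp
  rw [h _ fun a ha ↦ List.eq_of_mem_replicate ha, List.length_replicate]

/-- For every positive integer `k`, the multiple zeta value with `k` repeated twos equals
`π^{2k}/(2k+1)!`. -/
theorem stmt_5 (k : ℕ) (hk : 0 < k) :
    mzv (List.replicate k 2) = Real.pi ^ (2 * k) / (Nat.factorial (2 * k + 1) : ℝ) := by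
  rw [mzv_replicate_two]
  have h := tsum_card_eq_prod_one_div_sq k
  apply Complex.ofReal_injective
  rw [Complex.ofReal_tsum]
  simpa using h
end

section
/- Let D_w denote the dimension over ℚ of the ℚ-vector subspace of ℝ generated by all multiple zeta values ζ(s₁, …, s_l) of weight w (i.e., with s₁ + ⋯ + s_l = w, s_i positive integers, s₁ ≥ 2). Then for all integers w₁, w₂ ≥ 2 with w₁ ≥ w₂ + 2, one has D_{w₁} ≥ D_{w₂}. -/
open scoped BigOperators

/-- The truncated multiple harmonic sum `∑_{N ≥ n₁ > ⋯ > n_l ≥ 1} 1/(n₁^{s₁} ⋯ n_l^{s_l})`. -/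
noncomputable def truncMzv : List ℕ → ℕ → ℝ
  | [], _ => 1
  | a :: s, N => ∑ n ∈ Finset.range N, 1 / ((n + 1 : ℕ) : ℝ) ^ a * truncMzv s n

/-- The quasi-shuffle product of the one-letter word `k` with a word. -/
def quasiInsert (k : ℕ) : List ℕ → List (List ℕ)
  | [] => [[k]]
  | a :: s => (k :: a :: s) :: ((k + a) :: s) :: (quasiInsert k s).map (a :: ·)

theorem truncMzv_cons_succ (a : ℕ) (s : List ℕ) (N : ℕ) :
    truncMzv (a :: s) (N + 1) =
      truncMzv (a :: s) N + 1 / ((N + 1 : ℕ) : ℝ) ^ a * truncMzv s N := by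
  simp only [truncMzv, Finset.sum_range_succ]

theorem sum_truncMzv_map_cons_zero (a : ℕ) (L : List (List ℕ)) :
    ((L.map (a :: ·)).map fun t => truncMzv t 0).sum = 0 := by
  induction L with
  | nil => simp
  | cons t L ih => simpa [truncMzv] using ih

theorem sum_truncMzv_map_cons_succ (a : ℕ) (L : List (List ℕ)) (N : ℕ) :
    ((L.map (a :: ·)).map fun t => truncMzv t (N + 1)).sum =
      ((L.map (a :: ·)).map fun t => truncMzv t N).sum +
        1 / ((N + 1 : ℕ) : ℝ) ^ a * (L.map fun t => truncMzv t N).sum := by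
  induction L with
  | nil => simp
  | cons t L ih =>
    simp only [List.map_cons, List.sum_cons, truncMzv_cons_succ] at ih ⊢
    rw [ih]
    ring

theorem truncMzv_singleton_mul (k : ℕ) (s : List ℕ) (N : ℕ) :
    truncMzv [k] N * truncMzv s N = ((quasiInsert k s).map fun t => truncMzv t N).sum := by
  induction s generalizing N with
  | nil => simp [quasiInsert, truncMzv]
  | cons a s ihs =>
    simp only [quasiInsert, List.map_cons, List.sum_cons]
    induction N with
    | zero =>
      rw [sum_truncMzv_map_cons_zero]
      simp [truncMzv]
    | succ N ihN =>
      rw [sum_truncMzv_map_cons_succ, ← ihs]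
      simp only [truncMzv_cons_succ]
      have h1 : truncMzv [] N = 1 := rfl
      rw [h1, pow_add, one_div_mul_eq_div, one_div_mul_eq_div, ← one_div_mul_one_div]
      linear_combination ihN

theorem sum_of_mem_quasiInsert {k : ℕ} {s t : List ℕ} (ht : t ∈ quasiInsert k s) :
    t.sum = k + s.sum := by
  induction s generalizing t with
  | nil => simp_all [quasiInsert]
  | cons a s ih =>
    simp only [quasiInsert, List.mem_cons, List.mem_map] at ht
    rcases ht with rfl | rfl | ⟨u, hu, rfl⟩
    · simp
    · simp [add_assoc]
    · simp only [List.sum_cons, ih hu]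
      omega

theorem pos_of_mem_quasiInsert {k : ℕ} {s t : List ℕ} (hk : 0 < k) (hs : ∀ a ∈ s, 0 < a)
    (ht : t ∈ quasiInsert k s) : ∀ a ∈ t, 0 < a := by
  induction s generalizing t with
  | nil => simp_all [quasiInsert]
  | cons b s ih =>
    have hs' : ∀ a ∈ s, 0 < a := fun a ha => hs a (List.mem_cons_of_mem _ ha)
    have hb : 0 < b := hs b List.mem_cons_self
    simp only [quasiInsert, List.mem_cons, List.mem_map] at ht
    rcases ht with rfl | rfl | ⟨u, hu, rfl⟩
    · simp only [List.mem_cons, forall_eq_or_imp]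
      exact ⟨hk, hb, hs'⟩
    · simp only [List.mem_cons, forall_eq_or_imp]
      exact ⟨by omega, hs'⟩
    · simp only [List.mem_cons, forall_eq_or_imp]
      exact ⟨hb, ih hs' hu⟩

theorem IsComposition.of_mem_quasiInsert {k : ℕ} {s t : List ℕ} (hk : 2 ≤ k)
    (hs : IsComposition s) (ht : t ∈ quasiInsert k s) : IsComposition t := by
  have hpos := pos_of_mem_quasiInsert (by omega) hs.2.1 ht
  obtain ⟨hne, -, hhead⟩ := hs
  cases s with
  | nil => exact absurd rfl hne
  | cons b s =>
    simp only [List.headI_cons] at hhead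
    simp only [quasiInsert, List.mem_cons, List.mem_map] at ht
    rcases ht with rfl | rfl | ⟨u, hu, rfl⟩
    · exact ⟨by simp, hpos, by simpa using hk⟩
    · exact ⟨by simp, hpos, by simp only [List.headI_cons]; omega⟩
    · exact ⟨by simp, hpos, by simpa using hhead⟩

theorem truncMzv_nonneg (s : List ℕ) (N : ℕ) : 0 ≤ truncMzv s N := by
  induction s generalizing N with
  | nil => simp [truncMzv]
  | cons a s ih => exact Finset.sum_nonneg fun n _ => mul_nonneg (by positivity) (ih n)

theorem cast_harmonic_mono {m n : ℕ} (h : m ≤ n) : (harmonic m : ℝ) ≤ harmonic n := by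
  have : Monotone harmonic := monotone_nat_of_le_succ fun n => by
    rw [harmonic_succ]
    have : (0 : ℚ) ≤ ((n + 1 : ℕ) : ℚ)⁻¹ := by positivity
    linarith
  exact_mod_cast this h

theorem cast_harmonic_nonneg (n : ℕ) : (0 : ℝ) ≤ harmonic n := by
  simpa using cast_harmonic_mono (Nat.zero_le n)

theorem truncMzv_le_harmonic_pow {s : List ℕ} (hs : ∀ a ∈ s, 0 < a) (N : ℕ) :
    truncMzv s N ≤ (harmonic N : ℝ) ^ s.length := by
  induction s generalizing N with
  | nil => simp [truncMzv]
  | cons a s ih =>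
    have ha : 0 < a := hs a List.mem_cons_self
    have hs' : ∀ b ∈ s, 0 < b := fun b hb => hs b (List.mem_cons_of_mem _ hb)
    calc truncMzv (a :: s) N
        ≤ ∑ n ∈ Finset.range N, (((n + 1 : ℕ) : ℝ))⁻¹ * (harmonic N : ℝ) ^ s.length := by
          refine Finset.sum_le_sum fun n hn => ?_
          have hnN : n ≤ N := (Finset.mem_range.mp hn).le
          refine mul_le_mul ?_ ((ih hs' n).trans ?_) (truncMzv_nonneg _ _) (by positivity)
          · rw [one_div]
            refine inv_anti₀ (by positivity) (le_self_pow₀ ?_ ha.ne')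
            exact_mod_cast Nat.le_add_left 1 n
          · exact pow_le_pow_left₀ (cast_harmonic_nonneg n) (cast_harmonic_mono hnN) _
      _ = (harmonic N : ℝ) ^ (a :: s).length := by
          rw [← Finset.sum_mul, List.length_cons, pow_succ']
          congr 1
          simp [harmonic]

theorem summable_one_add_log_pow_div_sq (l : ℕ) :
    Summable fun n : ℕ => 1 / ((n + 1 : ℕ) : ℝ) ^ 2 * (1 + Real.log ((n + 1 : ℕ) : ℝ)) ^ l := by
  set ε : ℝ := 1 / (2 * (l + 1)) with hε
  have hε0 : 0 < ε := by positivity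
  have hlε : ε * l ≤ 1 / 2 := by
    rw [hε, div_mul_eq_mul_div, div_le_div_iff₀ (by positivity) (by positivity)]
    linarith
  have hsum : Summable fun n : ℕ => (1 + 1 / ε) ^ l * (1 / ((n + 1 : ℕ) : ℝ) ^ (3 / 2 : ℝ)) :=
    ((summable_nat_add_iff 1).mpr
      (Real.summable_one_div_nat_rpow.mpr (by norm_num : (1 : ℝ) < 3 / 2))).mul_left _
  refine hsum.of_nonneg_of_le (fun n => ?_) fun n => ?_
  · have : 0 ≤ Real.log ((n + 1 : ℕ) : ℝ) := Real.log_natCast_nonneg _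
    positivity
  · have hx : (1 : ℝ) ≤ ((n + 1 : ℕ) : ℝ) := by exact_mod_cast Nat.le_add_left 1 n
    generalize ((n + 1 : ℕ) : ℝ) = x at hx
    have hx0 : 0 < x := by linarith
    have hlog : 1 + Real.log x ≤ (1 + 1 / ε) * x ^ ε := by
      have h1 := Real.log_le_rpow_div hx0.le hε0
      have h2 := Real.one_le_rpow hx hε0.le
      have : (1 + 1 / ε) * x ^ ε = x ^ ε + x ^ ε / ε := by ring
      linarith
    have hpow : (1 + Real.log x) ^ l ≤ (1 + 1 / ε) ^ l * x ^ (1 / 2 : ℝ) := by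
      refine (pow_le_pow_left₀ (by linarith [Real.log_nonneg hx]) hlog l).trans ?_
      rw [mul_pow, ← Real.rpow_mul_natCast hx0.le]
      exact mul_le_mul_of_nonneg_left (Real.rpow_le_rpow_of_exponent_le hx hlε) (by positivity)
    have hx2 : x ^ 2 = x ^ (3 / 2 : ℝ) * x ^ (1 / 2 : ℝ) := by
      rw [← Real.rpow_add hx0, ← Real.rpow_natCast]
      norm_num
    have h12 : 0 < x ^ (1 / 2 : ℝ) := Real.rpow_pos_of_pos hx0 _
    have h32 : 0 < x ^ (3 / 2 : ℝ) := Real.rpow_pos_of_pos hx0 _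
    calc 1 / x ^ 2 * (1 + Real.log x) ^ l
        ≤ 1 / x ^ 2 * ((1 + 1 / ε) ^ l * x ^ (1 / 2 : ℝ)) := by gcongr
      _ = (1 + 1 / ε) ^ l * (1 / x ^ (3 / 2 : ℝ)) := by
        rw [hx2]
        field_simp

theorem IsComposition.exists_truncMzv_le {s : List ℕ} (hs : IsComposition s) :
    ∃ C, ∀ N, truncMzv s N ≤ C := by
  obtain ⟨hne, hpos, hhead⟩ := hs
  cases s with
  | nil => exact absurd rfl hne
  | cons a s =>
    simp only [List.headI_cons] at hhead
    have hs' : ∀ b ∈ s, 0 < b := fun b hb => hpos b (List.mem_cons_of_mem _ hb)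
    refine ⟨_, fun N => le_trans (Finset.sum_le_sum fun n _ => ?_)
      ((summable_one_add_log_pow_div_sq s.length).sum_le_tsum (Finset.range N) fun n _ => ?_)⟩
    · have h1 : (1 : ℝ) ≤ ((n + 1 : ℕ) : ℝ) := by exact_mod_cast Nat.le_add_left 1 n
      refine mul_le_mul ?_ ?_ (truncMzv_nonneg _ _) (by positivity)
      · exact one_div_le_one_div_of_le (by positivity) (pow_le_pow_right₀ h1 hhead)
      · refine (truncMzv_le_harmonic_pow hs' n).trans ?_
        exact pow_le_pow_left₀ (cast_harmonic_nonneg n)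
          ((cast_harmonic_mono n.le_succ).trans (harmonic_le_one_add_log _)) _
    · have : 0 ≤ Real.log ((n + 1 : ℕ) : ℝ) := Real.log_natCast_nonneg _
      positivity

/-- The strictly decreasing `l`-tuples of positive integers bounded by `N`. -/
def decreasingTuples : (l : ℕ) → ℕ → Finset (Fin l → ℕ)
  | 0, _ => Finset.univ
  | l + 1, N => (Finset.range N).biUnion fun n =>
      (decreasingTuples l n).image fun f => (Fin.cons (n + 1) f : Fin (l + 1) → ℕ)

theorem mem_decreasingTuples {l N : ℕ} {f : Fin l → ℕ} :
    f ∈ decreasingTuples l N ↔ (StrictAnti f ∧ ∀ i, 0 < f i) ∧ ∀ i, f i ≤ N := by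
  induction l generalizing N with
  | zero =>
    simp only [decreasingTuples, Finset.mem_univ, true_iff]
    exact ⟨⟨fun i => i.elim0, fun i => i.elim0⟩, fun i => i.elim0⟩
  | succ l ih =>
    simp only [decreasingTuples, Finset.mem_biUnion, Finset.mem_range, Finset.mem_image, ih]
    constructor
    · rintro ⟨n, hn, g, ⟨⟨hg, hg0⟩, hgn⟩, rfl⟩
      refine ⟨⟨?_, ?_⟩, ?_⟩
      · intro i j hij
        induction j using Fin.cases with
        | zero => exact absurd hij (Fin.not_lt_zero i)
        | succ j =>
          induction i using Fin.cases with
          | zero => simpa using Nat.lt_succ_of_le (hgn j)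
          | succ i => simpa using hg (Fin.succ_lt_succ_iff.mp hij)
      · intro i
        induction i using Fin.cases with
        | zero => simp
        | succ i => simpa using hg0 i
      · intro i
        induction i using Fin.cases with
        | zero => simpa using hn
        | succ i => simpa using (hgn i).trans hn.le
    · rintro ⟨⟨hf, hf0⟩, hfN⟩
      refine ⟨f 0 - 1, ?_, Fin.tail f, ⟨⟨?_, ?_⟩, ?_⟩, ?_⟩
      · have := hf0 0
        have := hfN 0
        omega
      · exact fun i j hij => hf (Fin.succ_lt_succ_iff.mpr hij)
      · exact fun i => hf0 i.succ
      · intro i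
        have : f i.succ < f 0 := hf (Fin.succ_pos i)
        simp only [Fin.tail]
        omega
      · rw [Nat.sub_add_cancel (hf0 0)]
        exact Fin.cons_self_tail f

theorem sum_decreasingTuples (s : List ℕ) (N : ℕ) :
    ∑ f ∈ decreasingTuples s.length N, ∏ i : Fin s.length, (1 : ℝ) / (f i : ℝ) ^ s.get i =
      truncMzv s N := by
  induction s generalizing N with
  | nil => simp [decreasingTuples, truncMzv]
  | cons a s ih =>
    simp only [List.length_cons, decreasingTuples, truncMzv]
    rw [Finset.sum_biUnion]
    · refine Finset.sum_congr rfl fun n _ => ?_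
      rw [Finset.sum_image (fun f _ g _ hfg => Fin.cons_right_injective _ hfg), ← ih,
        Finset.mul_sum]
      refine Finset.sum_congr rfl fun f _ => ?_
      rw [Fin.prod_univ_succ]
      simp
    · intro m _ n _ hmn
      rw [Function.onFun, Finset.disjoint_left]
      intro f hfm hfn
      obtain ⟨g, -, rfl⟩ := Finset.mem_image.mp hfm
      obtain ⟨g', -, h⟩ := Finset.mem_image.mp hfn
      have := congrFun h 0
      simp only [Fin.cons_zero] at this
      omega

theorem IsComposition.tendsto_truncMzv {s : List ℕ} (hs : IsComposition s) :
    Filter.Tendsto (truncMzv s) Filter.atTop (nhds (mzv s)) := by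
  classical
  let P : (Fin s.length → ℕ) → Prop := fun n => StrictAnti n ∧ ∀ i, 0 < n i
  let F : ℕ → Finset {n // P n} := fun N => (decreasingTuples s.length N).subtype P
  let φ : {n // P n} → ℝ := fun n => ∏ i : Fin s.length, (1 : ℝ) / (n.1 i : ℝ) ^ s.get i
  have hmem : ∀ N (n : {n // P n}), n ∈ F N ↔ ∀ i, n.1 i ≤ N := fun N n => by
    simp only [F, Finset.mem_subtype, mem_decreasingTuples]
    exact and_iff_right n.2
  have hφ : ∀ N, ∑ n ∈ F N, φ n = truncMzv s N := fun N => by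
    rw [← sum_decreasingTuples]
    exact Finset.sum_subtype_of_mem
      (fun n : Fin s.length → ℕ => ∏ i : Fin s.length, (1 : ℝ) / (n i : ℝ) ^ s.get i)
      fun n hn => (mem_decreasingTuples.mp hn).1
  have hF : Filter.Tendsto F Filter.atTop Filter.atTop := by
    refine Filter.tendsto_atTop_finset_of_monotone (fun M N hMN n hn => ?_) fun n => ?_
    · exact (hmem N n).mpr fun i => ((hmem M n).mp hn i).trans hMN
    · exact ⟨∑ i, n.1 i, (hmem _ n).mpr fun i =>
        Finset.single_le_sum (fun j _ => Nat.zero_le (n.1 j)) (Finset.mem_univ i)⟩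
  have hφ0 : ∀ n, 0 ≤ φ n := fun n => Finset.prod_nonneg fun i _ => by positivity
  obtain ⟨C, hC⟩ := hs.exists_truncMzv_le
  have hsum : Summable φ := by
    refine summable_of_sum_le hφ0 (c := C) fun u => ?_
    obtain ⟨N, hN⟩ := (hF.eventually_ge_atTop u).exists
    exact (Finset.sum_le_sum_of_subset_of_nonneg hN fun n _ _ => hφ0 n).trans
      ((hφ N).trans_le (hC N))
  exact (hsum.hasSum.comp hF).congr hφ

theorem isComposition_singleton {k : ℕ} (hk : 2 ≤ k) : IsComposition [k] :=
  ⟨by simp, by simpa using (by omega : 0 < k), by simpa using hk⟩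

theorem mzv_singleton_pos {k : ℕ} (hk : 2 ≤ k) : 0 < mzv [k] := by
  refine zero_lt_one.trans_le (ge_of_tendsto (isComposition_singleton hk).tendsto_truncMzv ?_)
  filter_upwards [Filter.eventually_ge_atTop 1] with N hN
  have h0 : (0 : ℕ) ∈ Finset.range N := Finset.mem_range.mpr hN
  calc (1 : ℝ) = 1 / ((0 + 1 : ℕ) : ℝ) ^ k * truncMzv [] 0 := by simp [truncMzv]
    _ ≤ truncMzv [k] N := Finset.single_le_sum
      (f := fun n : ℕ => 1 / ((n + 1 : ℕ) : ℝ) ^ k * truncMzv [] n)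
      (fun n _ => mul_nonneg (by positivity) (truncMzv_nonneg _ _)) h0

/-- The quasi-shuffle product formula for a zeta value times a multiple zeta value. -/
theorem mzv_singleton_mul {k : ℕ} {s : List ℕ} (hk : 2 ≤ k) (hs : IsComposition s) :
    mzv [k] * mzv s = ((quasiInsert k s).map mzv).sum := by
  have hlim := (isComposition_singleton hk).tendsto_truncMzv.mul hs.tendsto_truncMzv
  refine tendsto_nhds_unique hlim ?_
  simp only [truncMzv_singleton_mul]
  exact tendsto_list_sum _ fun t ht => (hs.of_mem_quasiInsert hk ht).tendsto_truncMzv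

/-- If `w₁ ≥ w₂ + 2` with `w₂ ≥ 2`, then the `ℚ`-dimension of the span of all multiple zeta
values of weight `w₁` is at least that of weight `w₂`. -/
theorem stmt_7 (w₁ w₂ : ℕ) (hw₂ : 2 ≤ w₂) (h : w₂ + 2 ≤ w₁) :
    Module.rank ℚ
      ↥(Submodule.span ℚ (mzv '' {s | IsComposition s ∧ s.sum = w₂})) ≤
    Module.rank ℚ
      ↥(Submodule.span ℚ (mzv '' {s | IsComposition s ∧ s.sum = w₁})) := by
  have hk : 2 ≤ w₁ - w₂ := by omega
  let φ : ℝ →ₗ[ℚ] ℝ := LinearMap.mulLeft ℚ (mzv [w₁ - w₂])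
  have hφ : Function.Injective φ := mul_right_injective₀ (mzv_singleton_pos hk).ne'
  rw [(Submodule.equivMapOfInjective φ hφ _).rank_eq]
  refine Submodule.rank_mono ((Submodule.map_span_le _ _ _).mpr ?_)
  rintro _ ⟨s, ⟨hs, rfl⟩, rfl⟩
  rw [LinearMap.mulLeft_apply, mzv_singleton_mul hk hs]
  refine list_sum_mem fun x hx => ?_
  obtain ⟨t, ht, rfl⟩ := List.mem_map.mp hx
  refine Submodule.subset_span ⟨t, ⟨hs.of_mem_quasiInsert hk ht, ?_⟩, rfl⟩
  rw [sum_of_mem_quasiInsert ht]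
  omega
end
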